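/- Let Φ : 𝔗(ℋ) → 𝔗(ℋ') be a quantum channel and Φ̃ its complementary channel. If any two of the three functions H, H_Φ, H_{Φ̃} are continuous on a set 𝒜 ⊆ 𝔗₊(ℋ), then the third one is also continuous on 𝒜. The same assertion holds for a quantum operation Φ provided λ*(√(I_ℋ − Φ*(I_{ℋ'}))) < +∞. -/

import Mathlib

open scoped ENNReal NNReal
open Filter Topology Classical
attribute [local instance] Classical.propDecidable

noncomputable section

namespace QIT

section Defs

variable {E F G : Type*}
variable [NormedAddCommGroup E] [InnerProductSpace ℂ E] [CompleteSpace E]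
variable [NormedAddCommGroup F] [InnerProductSpace ℂ F] [CompleteSpace F]
variable [NormedAddCommGroup G] [InnerProductSpace ℂ G] [CompleteSpace G]

/-- The real part of `⟪x, A x⟫`. -/
def qf (A : E →L[ℂ] E) (x : E) : ℝ := (inner ℂ x (A x) : ℂ).re

/-- The trace of a positive operator, as the supremum of finite diagonal sums over
finite orthonormal families.  For positive operators this coincides with the usual
trace (with value `∞` when the operator is not trace class). -/
def traceENN (A : E →L[ℂ] E) : ℝ≥0∞ :=
  ⨆ (n : ℕ) (e : Fin n → E) (_ : Orthonormal ℂ e), ∑ i, ENNReal.ofReal (qf A (e i))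

/-- The trace norm `‖A‖₁`, as the supremum of `∑ |⟪e i, A (f i)⟫|` over pairs of finite
orthonormal families; it is finite exactly on trace-class operators. -/
def traceNorm (A : E →L[ℂ] E) : ℝ≥0∞ :=
  ⨆ (n : ℕ) (e : Fin n → E) (f : Fin n → E) (_ : Orthonormal ℂ e) (_ : Orthonormal ℂ f),
    ∑ i, ENNReal.ofReal ‖(inner ℂ (e i) (A (f i)) : ℂ)‖

/-- `A` is a trace-class operator. -/
def IsTC (A : E →L[ℂ] E) : Prop := traceNorm A ≠ ∞

/-- The cone `𝔗₊(E)` of positive trace-class operators. -/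
def posTC (E : Type*) [NormedAddCommGroup E] [InnerProductSpace ℂ E] [CompleteSpace E] :
    Set (E →L[ℂ] E) := {A | A.IsPositive ∧ IsTC A}

/-- The set `𝔖(E)` of states (density operators). -/
def states (E : Type*) [NormedAddCommGroup E] [InnerProductSpace ℂ E] [CompleteSpace E] :
    Set (E →L[ℂ] E) := {A | A.IsPositive ∧ traceENN A = 1}

/-- The extended classical entropy `H({x_i}) = ∑ η(x_i) − η(∑ x_i)` of a nonnegative
summable family, written in the equivalent homogeneous form `(∑ x) · H({x_i/∑x})`. -/
def clEntropy {ι : Type*} (x : ι → ℝ) : ℝ≥0∞ :=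
  ENNReal.ofReal (∑' i, x i) *
    ∑' i, ENNReal.ofReal (Real.negMulLog (x i / (∑' j, x j)))

/-- An orthonormal subset with dense span (an orthonormal basis, as a set). -/
def IsONB (s : Set E) : Prop :=
  Orthonormal ℂ ((↑) : s → E) ∧ Dense ((Submodule.span ℂ s : Submodule ℂ E) : Set E)

/-- The quantum (von Neumann) entropy `H(A) = Tr η(A) − η(Tr A)` of a positive trace-class
operator, realized as the infimum over all orthonormal bases of the classical entropy of
the diagonal of `A` (the infimum is attained on an eigenbasis of `A`). -/
def qEntropy (A : E →L[ℂ] E) : ℝ≥0∞ :=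
  ⨅ (s : Set E) (_ : IsONB s), clEntropy fun v : s => qf A v

theorem exists_isONB (E : Type*) [NormedAddCommGroup E] [InnerProductSpace ℂ E]
    [CompleteSpace E] : ∃ s : Set E, IsONB s := by
  obtain ⟨w, b, hb⟩ := exists_hilbertBasis ℂ E
  refine ⟨w, ?_, ?_⟩
  · have h := b.orthonormal
    rwa [hb] at h
  · have h := b.dense_span
    rw [hb, Subtype.range_coe] at h
    rwa [Submodule.dense_iff_topologicalClosure_eq_top]

/-- A fixed orthonormal basis (as a set). -/
def stdONB (E : Type*) [NormedAddCommGroup E] [InnerProductSpace ℂ E] [CompleteSpace E] :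
    Set E := (exists_isONB E).choose

/-- The `ℂ`-valued trace, computed in a fixed orthonormal basis; for trace-class
operators it does not depend on the choice of the basis. -/
def traceC (A : E →L[ℂ] E) : ℂ := ∑' v : stdONB E, (inner ℂ (v : E) (A v) : ℂ)

/-- Continuity (including finiteness) of an `ℝ≥0∞`-valued function on a subset of
operators, with respect to the trace-norm distance. -/
def ContOn (f : (E →L[ℂ] E) → ℝ≥0∞) (𝒜 : Set (E →L[ℂ] E)) : Prop :=
  (∀ A ∈ 𝒜, f A ≠ ∞) ∧
  ∀ A ∈ 𝒜, ∀ ε : ℝ, 0 < ε → ∃ δ : ℝ, 0 < δ ∧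
    ∀ B ∈ 𝒜, traceNorm (B - A) < ENNReal.ofReal δ → |(f B).toReal - (f A).toReal| < ε

/-- Continuity of a real-valued function on a subset of operators with respect to the
trace-norm distance. -/
def RContOn (g : (E →L[ℂ] E) → ℝ) (𝒜 : Set (E →L[ℂ] E)) : Prop :=
  ∀ A ∈ 𝒜, ∀ ε : ℝ, 0 < ε → ∃ δ : ℝ, 0 < δ ∧
    ∀ B ∈ 𝒜, traceNorm (B - A) < ENNReal.ofReal δ → |g B - g A| < ε

/-- Boundedness of an `ℝ≥0∞`-valued function on a set. -/
def BddOn (f : (E →L[ℂ] E) → ℝ≥0∞) (𝒜 : Set (E →L[ℂ] E)) : Prop :=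
  ∃ C : ℝ, ∀ A ∈ 𝒜, f A ≤ ENNReal.ofReal C

/-- Convergence of a sequence of operators in the trace norm. -/
def TendstoTN (A : ℕ → (E →L[ℂ] E)) (A₀ : E →L[ℂ] E) : Prop :=
  ∀ ε : ℝ, 0 < ε → ∃ N : ℕ, ∀ n ≥ N, traceNorm (A n - A₀) < ENNReal.ofReal ε

/-- A positive linear map from the trace class of `E` to the trace class of `F`
(the values of `toFun` outside the trace class are irrelevant). -/
structure TraceMap (E F : Type*) [NormedAddCommGroup E] [InnerProductSpace ℂ E]
    [CompleteSpace E] [NormedAddCommGroup F] [InnerProductSpace ℂ F] [CompleteSpace F] where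
  toFun : (E →L[ℂ] E) → (F →L[ℂ] F)
  map_add : ∀ A B, IsTC A → IsTC B → toFun (A + B) = toFun A + toFun B
  map_smul : ∀ (c : ℂ) A, IsTC A → toFun (c • A) = c • toFun A
  maps_tc : ∀ A, IsTC A → IsTC (toFun A)
  pos : ∀ A, IsTC A → A.IsPositive → (toFun A).IsPositive

/-- A trace-non-increasing map. -/
def TraceMap.TNI (Φ : TraceMap E F) : Prop :=
  ∀ A, IsTC A → A.IsPositive → traceENN (Φ.toFun A) ≤ traceENN A

/-- A trace-preserving map. -/
def TraceMap.TP (Φ : TraceMap E F) : Prop :=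
  ∀ A, IsTC A → A.IsPositive → traceENN (Φ.toFun A) = traceENN A

/-- A map bounded with respect to the trace norm. -/
def TraceMap.Bounded (Φ : TraceMap E F) : Prop :=
  ∃ C : ℝ≥0, ∀ A, traceNorm (Φ.toFun A) ≤ (C : ℝ≥0∞) * traceNorm A

/-- The output entropy `H_Φ = H ∘ Φ`. -/
def outEntropy (Φ : TraceMap E F) (A : E →L[ℂ] E) : ℝ≥0∞ := qEntropy (Φ.toFun A)

/-- The rank-one operator `|x⟩⟨x|`. -/
def rankOne (x : E) : E →L[ℂ] E := (innerSL ℂ x).smulRight x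

/-- The rank-one operator `|x⟩⟨y|`. -/
def rankOneM (x y : E) : E →L[ℂ] E := (innerSL ℂ y).smulRight x

end Defs

section Defs2

variable {E F G : Type*}
variable [NormedAddCommGroup E] [InnerProductSpace ℂ E] [CompleteSpace E]
variable [NormedAddCommGroup F] [InnerProductSpace ℂ F] [CompleteSpace F]
variable [NormedAddCommGroup G] [InnerProductSpace ℂ G] [CompleteSpace G]

/-- The completely positive map `A ↦ ∑ᵢ Vᵢ A Vᵢ*` defined by a sequence of Kraus
operators. -/
def krausMap (V : ℕ → (E →L[ℂ] F)) (A : E →L[ℂ] E) : F →L[ℂ] F :=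
  ∑' i, V i ∘L A ∘L ContinuousLinearMap.adjoint (V i)

/-- The Kraus condition `∑ᵢ Vᵢ* Vᵢ ≤ I` (all partial sums are dominated by `I`). -/
def KrausTNI (V : ℕ → (E →L[ℂ] F)) : Prop :=
  ∀ n : ℕ,
    ((1 : E →L[ℂ] E) - ∑ i ∈ Finset.range n, ContinuousLinearMap.adjoint (V i) ∘L V i).IsPositive

/-- The Kraus condition `∑ᵢ Vᵢ* Vᵢ = I` (strong convergence), i.e. trace preservation. -/
def KrausTP (V : ℕ → (E →L[ℂ] F)) : Prop :=
  ∀ x : E, HasSum (fun i => (ContinuousLinearMap.adjoint (V i)) (V i x)) x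

/-- `(Φ, Φt)` is a complementary pair of quantum operations: for some Kraus
representation `Φ(·) = ∑ᵢ Vᵢ (·) Vᵢ*` and some orthonormal basis `{bᵢ}` of `G`,
`Φt(A) = ∑_{i,j} Tr[Vᵢ A Vⱼ*] |bᵢ⟩⟨bⱼ|` (characterized by its matrix entries). -/
def IsComplementaryPair (Φ : TraceMap E F) (Φt : TraceMap E G) : Prop :=
  ∃ (V : ℕ → (E →L[ℂ] F)) (b : HilbertBasis ℕ ℂ G),
    KrausTNI V ∧
    (∀ A, IsTC A → Φ.toFun A = krausMap V A) ∧
    (∀ A, IsTC A → ∀ i j : ℕ,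
      (inner ℂ (b i) (Φt.toFun A (b j)) : ℂ) =
        traceC (V i ∘L A ∘L ContinuousLinearMap.adjoint (V j)))

/-- A map (on trace-class operators) preserves continuity of the entropy:
its output entropy is continuous on every subset of the positive trace-class cone on
which the von Neumann entropy is continuous. -/
def PCE (Φf : (E →L[ℂ] E) → (F →L[ℂ] F)) : Prop :=
  ∀ 𝒜 : Set (E →L[ℂ] E), 𝒜 ⊆ posTC E → ContOn qEntropy 𝒜 →
    ContOn (fun A => qEntropy (Φf A)) 𝒜

/-- `μ` is the sequence of nonzero eigenvalues (with multiplicities, possibly padded by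
zeros) of the diagonalizable positive operator `T`, every vector orthogonal to the
eigenvectors being annihilated by `T`. -/
def IsEigenSeq (T : E →L[ℂ] E) (μ : ℕ → ℝ) : Prop :=
  ∃ e : ℕ → E,
    (∀ i j, i ≠ j → (inner ℂ (e i) (e j) : ℂ) = 0) ∧
    (∀ i, (μ i ≠ 0 → ‖e i‖ = 1) ∧ (μ i = 0 → e i = 0)) ∧
    (∀ i, T (e i) = (μ i : ℂ) • e i) ∧
    (∀ x : E, (∀ i, (inner ℂ (e i) x : ℂ) = 0) → T x = 0)

/-- `ν` is the sequence of singular values of `V` (eigenvalues of `√(V*V)`,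
equivalently `ν²` are the eigenvalues of `V*V`). -/
def IsSingularValues (V : E →L[ℂ] F) (ν : ℕ → ℝ) : Prop :=
  (∀ i, 0 ≤ ν i) ∧ IsEigenSeq (ContinuousLinearMap.adjoint V ∘L V) (fun i => ν i ^ 2)

/-- `∑ᵢ e^{−l/νᵢ²}`, the sum being taken over the indices with `νᵢ ≠ 0`. -/
def expSum (ν : ℕ → ℝ) (l : ℝ) : ℝ≥0∞ :=
  ∑' i, if ν i = 0 then 0 else ENNReal.ofReal (Real.exp (-(l / ν i ^ 2)))

/-- `λ*(V) < ∞`: `V` is compact (automatic here) and `∑ᵢ e^{−l/νᵢ²} < ∞` for some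
`l > 0`, where `{νᵢ}` are the singular values of `V`. -/
def LamStarFin (V : E →L[ℂ] F) : Prop :=
  ∃ ν : ℕ → ℝ, IsSingularValues V ν ∧ ∃ l : ℝ, 0 < l ∧ expSum ν l ≠ ∞

/-- `λ*(√S) < ∞` for a positive operator `S` (the singular values of `√S` are the
square roots of the eigenvalues of `S`). -/
def LamStarSqrtFin (S : E →L[ℂ] E) : Prop :=
  ∃ ν : ℕ → ℝ, (∀ i, 0 ≤ ν i) ∧ IsEigenSeq S (fun i => ν i ^ 2) ∧
    ∃ l : ℝ, 0 < l ∧ expSum ν l ≠ ∞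

/-- The value `λ*` associated to a sequence `ν` of singular values: the unique solution
of `∑ᵢ e^{−λ/νᵢ²} = 1` if it exists, and `inf{λ > 0 | ∑ᵢ e^{−λ/νᵢ²} < ∞}` otherwise. -/
def lamStarOf (ν : ℕ → ℝ) : ℝ≥0∞ :=
  if h : ∃ l : ℝ, expSum ν l = 1 then ENNReal.ofReal h.choose
  else ⨅ (l : ℝ) (_ : 0 < l ∧ expSum ν l ≠ ∞), ENNReal.ofReal l

/-- The parameter `λ*(V) ∈ [0,∞]` of a bounded operator `V`. -/
def lamStar (V : E →L[ℂ] F) : ℝ≥0∞ :=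
  if h : ∃ ν : ℕ → ℝ, IsSingularValues V ν then lamStarOf h.choose else ∞

/-- `rank A ≤ k`. -/
def rankLE (A : E →L[ℂ] E) (k : ℕ) : Prop :=
  Module.rank ℂ (LinearMap.range (A : E →ₗ[ℂ] E)) ≤ k

/-- The set `𝔗₊ᵏ(E)` of positive (trace-class) operators of rank at most `k`. -/
def rankCone (E : Type*) [NormedAddCommGroup E] [InnerProductSpace ℂ E] [CompleteSpace E]
    (k : ℕ) : Set (E →L[ℂ] E) := {A | A.IsPositive ∧ rankLE A k}

/-- A decomposition of `A` into a countable convex combination of positive operators of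
rank at most `k`. -/
structure Decomp (k : ℕ) (A : E →L[ℂ] E) where
  π : ℕ → ℝ
  op : ℕ → (E →L[ℂ] E)
  π_nonneg : ∀ i, 0 ≤ π i
  π_sum : HasSum π 1
  op_pos : ∀ i, (op i).IsPositive
  op_rank : ∀ i, rankLE (op i) k
  sum_eq : HasSum (fun i => π i • op i) A

/-- The `k`-order approximator `H_Φᵏ` of the output entropy of `Φ`. -/
def kApprox (Φf : (E →L[ℂ] E) → (F →L[ℂ] F)) (k : ℕ) (A : E →L[ℂ] E) : ℝ≥0∞ :=
  ⨆ d : Decomp k A, ∑' i, ENNReal.ofReal (d.π i) * qEntropy (Φf (d.op i))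

/-- The set of pure states (extreme points of `𝔖(E)`). -/
def pureStates (E : Type*) [NormedAddCommGroup E] [InnerProductSpace ℂ E]
    [CompleteSpace E] : Set (E →L[ℂ] E) := {A | ∃ x : E, ‖x‖ = 1 ∧ A = rankOne x}

end Defs2

section Tensor

variable (E F G : Type*)
variable [NormedAddCommGroup E] [InnerProductSpace ℂ E] [CompleteSpace E]
variable [NormedAddCommGroup F] [InnerProductSpace ℂ F] [CompleteSpace F]
variable [NormedAddCommGroup G] [InnerProductSpace ℂ G] [CompleteSpace G]

/-- A realization of `G` as the Hilbert tensor product `E ⊗ F`, together with the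
tensor product of (bounded) operators. -/
structure TensorData where
  tmul : E → F → G
  add_left : ∀ x y z, tmul (x + y) z = tmul x z + tmul y z
  add_right : ∀ x y z, tmul x (y + z) = tmul x y + tmul x z
  smul_left : ∀ (c : ℂ) x y, tmul (c • x) y = c • tmul x y
  smul_right : ∀ (c : ℂ) x y, tmul x (c • y) = c • tmul x y
  inner_tmul : ∀ x x' y y',
    (inner ℂ (tmul x y) (tmul x' y') : ℂ) = (inner ℂ x x' : ℂ) * (inner ℂ y y' : ℂ)
  dense_span : Dense ((Submodule.span ℂ {z | ∃ x y, z = tmul x y} : Submodule ℂ G) : Set G)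
  omul : (E →L[ℂ] E) → (F →L[ℂ] F) → (G →L[ℂ] G)
  omul_tmul : ∀ A B x y, omul A B (tmul x y) = tmul (A x) (B y)

end Tensor

set_option linter.unusedSectionVars false

section ClassicalEntropy

variable {ι κ : Type*}

theorem mul_log_div_le {x X a : ℝ} (hx : 0 ≤ x) (hX : x ≤ X) (ha : 0 < a) :
    x * Real.log (X / x) ≤ x * Real.log a + (X / a - x) := by
  rcases hx.eq_or_lt with rfl | hx
  · simpa using div_nonneg hX ha.le
  have hX0 : 0 < X := hx.trans_le hX
  have h := Real.log_le_sub_one_of_pos (show 0 < X / (a * x) by positivity)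
  have h2 : Real.log (X / x) = Real.log a + Real.log (X / (a * x)) := by
    rw [← Real.log_mul (by positivity) (by positivity)]
    congr 1
    field_simp
  have h3 : x * (X / (a * x)) = X / a := by field_simp
  rw [h2]
  nlinarith

theorem mul_log_div_nonneg {x X : ℝ} (hx : 0 ≤ x) (hX : x ≤ X) :
    0 ≤ x * Real.log (X / x) := by
  rcases hx.eq_or_lt with rfl | hx
  · simp
  · exact mul_nonneg hx.le (Real.log_nonneg ((one_le_div hx).2 hX))

theorem le_of_hasSum_nonneg {x : ι → ℝ} {X : ℝ} (hx : ∀ i, 0 ≤ x i) (h : HasSum x X) (i : ι) :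
    x i ≤ X := le_hasSum h i fun j _ => hx j

theorem tsum_ofReal_of_hasSum {x : ι → ℝ} {X : ℝ} (hx : ∀ i, 0 ≤ x i) (h : HasSum x X) :
    ∑' i, ENNReal.ofReal (x i) = ENNReal.ofReal X := by
  rw [← ENNReal.ofReal_tsum_of_nonneg hx h.summable, h.tsum_eq]

theorem hasSum_of_tsum_ofReal {x : ι → ℝ} {X : ℝ} (hx : ∀ i, 0 ≤ x i) (hX : 0 ≤ X)
    (h : ∑' i, ENNReal.ofReal (x i) = ENNReal.ofReal X) : HasSum x X := by
  have hs : Summable x := by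
    have := ENNReal.summable_toReal (h.trans_ne ENNReal.ofReal_ne_top)
    simpa [ENNReal.toReal_ofReal, hx] using this
  have h2 := ENNReal.ofReal_tsum_of_nonneg hx hs
  rw [h, ENNReal.ofReal_eq_ofReal_iff (tsum_nonneg hx) hX] at h2
  exact h2 ▸ hs.hasSum

theorem clEntropy_eq {x : ι → ℝ} {X : ℝ} (hx : ∀ i, 0 ≤ x i) (h : HasSum x X) :
    clEntropy x = ∑' i, ENNReal.ofReal (x i * Real.log (X / x i)) := by
  have hX : 0 ≤ X := h.nonneg hx
  rw [clEntropy, h.tsum_eq, ← ENNReal.tsum_mul_left]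
  refine tsum_congr fun i => ?_
  rw [← ENNReal.ofReal_mul hX]
  congr 1
  rcases hX.eq_or_lt with rfl | hX
  · have : x i = 0 := le_antisymm (le_of_hasSum_nonneg hx h i) (hx i)
    simp [this]
  · rw [Real.negMulLog, ← inv_div (x i) X, Real.log_inv]
    field_simp

theorem clEntropy_comp_equiv (e : ι ≃ κ) (x : κ → ℝ) : clEntropy (fun i => x (e i)) = clEntropy x := by
  unfold clEntropy
  rw [e.tsum_eq x]
  congr 1
  exact e.tsum_eq fun i => ENNReal.ofReal (Real.negMulLog (x i / ∑' j, x j))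

theorem clEntropy_add_le {x y : ι → ℝ} {X Y : ℝ} (hx : ∀ i, 0 ≤ x i) (hy : ∀ i, 0 ≤ y i)
    (hX : HasSum x X) (hY : HasSum y Y) :
    clEntropy x + clEntropy y ≤ clEntropy fun i => x i + y i := by
  rw [clEntropy_eq hx hX, clEntropy_eq hy hY,
    clEntropy_eq (fun i => add_nonneg (hx i) (hy i)) (hX.add hY), ← ENNReal.tsum_add]
  refine ENNReal.tsum_le_tsum fun i => ?_
  have hxi := le_of_hasSum_nonneg hx hX i
  have hyi := le_of_hasSum_nonneg hy hY i
  rw [← ENNReal.ofReal_add (mul_log_div_nonneg (hx i) hxi) (mul_log_div_nonneg (hy i) hyi)]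
  refine ENNReal.ofReal_le_ofReal ?_
  rcases (add_nonneg (hx i) (hy i)).eq_or_lt with h0 | h0
  · have h1 : x i = 0 := by linarith [hx i, hy i]
    have h2 : y i = 0 := by linarith [hx i, hy i]
    simp [h1, h2]
  · have hT : 0 < X + Y := by linarith
    have ha : 0 < (X + Y) / (x i + y i) := by positivity
    have h1 := mul_log_div_le (hx i) hxi ha
    have h2 := mul_log_div_le (hy i) hyi ha
    have h3 : X / ((X + Y) / (x i + y i)) + Y / ((X + Y) / (x i + y i)) = x i + y i := by
      field_simp
    linarith [add_mul (x i) (y i) (Real.log ((X + Y) / (x i + y i)))]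

theorem clEntropy_mono {x y : ι → ℝ} (hx : ∀ i, 0 ≤ x i) (hxy : ∀ i, x i ≤ y i)
    (hy : Summable y) : clEntropy x ≤ clEntropy y := by
  have hsx : Summable x := hy.of_nonneg_of_le hx hxy
  have h := clEntropy_add_le hx (fun i => sub_nonneg.2 (hxy i)) hsx.hasSum (hy.sub hsx).hasSum
  simp only [add_sub_cancel] at h
  exact le_self_add.trans h

theorem clEntropy_const_mul {x : ι → ℝ} {c : ℝ} (hc : 0 ≤ c) (hx : ∀ i, 0 ≤ x i)
    (hs : Summable x) : clEntropy (fun i => c * x i) = ENNReal.ofReal c * clEntropy x := by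
  rw [clEntropy_eq hx hs.hasSum,
    clEntropy_eq (fun i => mul_nonneg hc (hx i)) (hs.hasSum.mul_left c), ← ENNReal.tsum_mul_left]
  refine tsum_congr fun i => ?_
  rw [← ENNReal.ofReal_mul hc]
  rcases hc.eq_or_lt with rfl | hc
  · simp
  · rw [mul_div_mul_left _ _ hc.ne', mul_assoc]

theorem tsum_mul_log_div_eq {u : ι → ℝ} {U T : ℝ} (hu : ∀ i, 0 ≤ u i) (hU : HasSum u U)
    (hT : U ≤ T) :
    ∑' i, ENNReal.ofReal (u i * Real.log (T / u i)) =
      ∑' i, ENNReal.ofReal (u i * Real.log (U / u i)) + ENNReal.ofReal (U * Real.log (T / U)) := by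
  have hU0 : 0 ≤ U := hU.nonneg hu
  have hl : 0 ≤ U * Real.log (T / U) := mul_log_div_nonneg hU0 hT
  rcases hU0.eq_or_lt with rfl | hUp
  · have : ∀ i, u i = 0 := fun i => le_antisymm (le_of_hasSum_nonneg hu hU i) (hu i)
    simp [this]
  have hlog : 0 ≤ Real.log (T / U) := Real.log_nonneg ((one_le_div hUp).2 hT)
  rw [ENNReal.ofReal_mul hU0, ← tsum_ofReal_of_hasSum hu hU, ← ENNReal.tsum_mul_right,
    ← ENNReal.tsum_add]
  refine tsum_congr fun i => ?_
  have hui := le_of_hasSum_nonneg hu hU i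
  rw [← ENNReal.ofReal_mul (hu i),
    ← ENNReal.ofReal_add (mul_log_div_nonneg (hu i) hui) (mul_nonneg (hu i) hlog)]
  congr 1
  rcases (hu i).eq_or_lt with h | h
  · simp [← h]
  · rw [← mul_add, ← Real.log_mul (by positivity) (by have := hUp.trans_le hT; positivity)]
    congr 2
    field_simp

theorem clEntropy_sumElim_le {x : ι → ℝ} {y : κ → ℝ} {X Y : ℝ} (hx : ∀ i, 0 ≤ x i)
    (hy : ∀ i, 0 ≤ y i) (hX : HasSum x X) (hY : HasSum y Y) :
    clEntropy (Sum.elim x y) ≤ clEntropy x + clEntropy y +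
      (ENNReal.ofReal (X * Real.log ((X + Y) / X)) + ENNReal.ofReal (Y * Real.log ((X + Y) / Y))) := by
  have hz : ∀ i, 0 ≤ Sum.elim x y i := by rintro (i | i) <;> simp [hx, hy]
  have hZ : HasSum (Sum.elim x y) (X + Y) := by
    exact HasSum.sum (f := Sum.elim x y) hX hY
  have hX0 : 0 ≤ X := hX.nonneg hx
  have hY0 : 0 ≤ Y := hY.nonneg hy
  rw [clEntropy_eq hz hZ, ENNReal.summable.tsum_sum ENNReal.summable, clEntropy_eq hx hX,
    clEntropy_eq hy hY]
  simp only [Sum.elim_inl, Sum.elim_inr]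
  rw [tsum_mul_log_div_eq hx hX (show X ≤ X + Y by linarith),
    tsum_mul_log_div_eq hy hY (show Y ≤ X + Y by linarith)]
  exact le_of_eq (by abel)

theorem clEntropy_prod_le {z : ι × κ → ℝ} {a : ι → ℝ} {b : κ → ℝ} {T : ℝ} (hz : ∀ p, 0 ≤ z p)
    (hT : HasSum z T) (ha : ∀ i, HasSum (fun k => z (i, k)) (a i))
    (hb : ∀ k, HasSum (fun i => z (i, k)) (b k)) :
    clEntropy z ≤ clEntropy a + clEntropy b := by
  have ha0 : ∀ i, 0 ≤ a i := fun i => (ha i).nonneg fun k => hz _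
  have hb0 : ∀ i, 0 ≤ b i := fun k => (hb k).nonneg fun i => hz _
  have hT0 : 0 ≤ T := hT.nonneg hz
  have haT : HasSum a T := hT.prod_fiberwise ha
  have hbT : HasSum b T := by
    have := (Equiv.prodComm κ ι).hasSum_iff.2 hT
    exact this.prod_fiberwise hb
  rcases hT0.eq_or_lt with rfl | hTp
  · have : ∀ i, z i = 0 := fun i => le_antisymm (le_of_hasSum_nonneg hz hT i) (hz i)
    rw [clEntropy_eq hz hT]
    simp [this]
  have key : ∀ i k, z (i, k) * Real.log (T / z (i, k)) + z (i, k) ≤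
      z (i, k) * Real.log (T / a i) + z (i, k) * Real.log (T / b k) + a i * b k / T := by
    intro i k
    rcases (hz (i, k)).eq_or_lt with h0 | h0
    · rw [← h0]
      have := ha0 i
      have := hb0 k
      simp only [zero_mul, zero_add]
      positivity
    have hap : 0 < a i := h0.trans_le (le_of_hasSum_nonneg (fun k => hz (i, k)) (ha i) k)
    have hbp : 0 < b k := h0.trans_le (le_of_hasSum_nonneg (fun i => hz (i, k)) (hb k) i)
    have h := mul_log_div_le h0.le (le_of_hasSum_nonneg hz hT (i, k))
      (show 0 < T / a i * (T / b k) by positivity)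
    rw [Real.log_mul (by positivity) (by positivity)] at h
    have h2 : T / (T / a i * (T / b k)) = a i * b k / T := by field_simp
    rw [h2] at h
    linarith
  have hla : ∀ i, 0 ≤ a i → 0 ≤ Real.log (T / a i) := fun i h => by
    rcases h.eq_or_lt with h | h
    · simp [← h]
    · exact Real.log_nonneg ((one_le_div h).2 (le_of_hasSum_nonneg ha0 haT i))
  have hlb : ∀ i, 0 ≤ b i → 0 ≤ Real.log (T / b i) := fun i h => by
    rcases h.eq_or_lt with h | h
    · simp [← h]
    · exact Real.log_nonneg ((one_le_div h).2 (le_of_hasSum_nonneg hb0 hbT i))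
  have hzl : ∀ p, 0 ≤ z p * Real.log (T / z p) := fun p =>
    mul_log_div_nonneg (hz p) (le_of_hasSum_nonneg hz hT p)
  have e1 : ∑' p : ι × κ, ENNReal.ofReal (z p * Real.log (T / a p.1)) = clEntropy a := by
    rw [clEntropy_eq ha0 haT, ENNReal.tsum_prod']
    refine tsum_congr fun i => ?_
    simp only [ENNReal.ofReal_mul (hz _), ENNReal.ofReal_mul (ha0 _)]
    rw [ENNReal.tsum_mul_right, tsum_ofReal_of_hasSum (fun k => hz (i, k)) (ha i)]
  have e2 : ∑' p : ι × κ, ENNReal.ofReal (z p * Real.log (T / b p.2)) = clEntropy b := by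
    rw [clEntropy_eq hb0 hbT, ENNReal.tsum_prod', ENNReal.tsum_comm]
    refine tsum_congr fun i => ?_
    simp only [ENNReal.ofReal_mul (hz _), ENNReal.ofReal_mul (hb0 _)]
    rw [ENNReal.tsum_mul_right, tsum_ofReal_of_hasSum (fun k => hz (k, i)) (hb i)]
  have e3 : ∑' p : ι × κ, ENNReal.ofReal (a p.1 * b p.2 / T) = ENNReal.ofReal T := by
    rw [ENNReal.tsum_prod']
    have : ∀ i, ∑' k, ENNReal.ofReal (a i * b k / T) = ENNReal.ofReal (a i) := fun i => by
      have h := tsum_ofReal_of_hasSum (fun k => by have := ha0 i; have := hb0 k; positivity)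
        ((hbT.mul_left (a i)).div_const T)
      rw [h, mul_div_cancel_right₀ _ hTp.ne']
    simp only [this]
    exact tsum_ofReal_of_hasSum ha0 haT
  have main : clEntropy z + ENNReal.ofReal T ≤ clEntropy a + clEntropy b + ENNReal.ofReal T := by
    rw [← e1, ← e2]
    nth_rewrite 2 [← e3]
    rw [clEntropy_eq hz hT, ← tsum_ofReal_of_hasSum hz hT, ← ENNReal.tsum_add, ← ENNReal.tsum_add,
      ← ENNReal.tsum_add]
    refine ENNReal.tsum_le_tsum ?_
    rintro ⟨i, k⟩
    have h1 := mul_nonneg (hz (i, k)) (hla i (ha0 i))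
    have h2 := mul_nonneg (hz (i, k)) (hlb k (hb0 k))
    have h3 : 0 ≤ a i * b k / T := by have := ha0 i; have := hb0 k; positivity
    rw [← ENNReal.ofReal_add (hzl _) (hz _), ← ENNReal.ofReal_add h1 h2,
      ← ENNReal.ofReal_add (add_nonneg h1 h2) h3]
    exact ENNReal.ofReal_le_ofReal (key i k)
  exact (ENNReal.add_le_add_iff_right ENNReal.ofReal_ne_top).1 main

/-- Gibbs' inequality against the distribution proportional to `exp (-l / ν²)`. -/
theorem clEntropy_le_of_expSum {ν y : ℕ → ℝ} {l X Y : ℝ} (hl : 0 < l) (hy : ∀ i, 0 ≤ y i)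
    (hexp : expSum ν l ≠ ∞) (hX : HasSum (fun i => ν i ^ 2 * y i) X) (hY : HasSum y Y) :
    clEntropy (fun i => ν i ^ 2 * y i) ≤
      ENNReal.ofReal (l * Y + X * Real.log ((expSum ν l).toReal + 1)) := by
  set Z := (expSum ν l).toReal + 1 with hZ
  have hZ1 : 1 ≤ Z := by rw [hZ]; linarith [ENNReal.toReal_nonneg (a := expSum ν l)]
  have hZ0 : 0 < Z := by linarith
  have hlZ : 0 ≤ Real.log Z := Real.log_nonneg hZ1
  set x : ℕ → ℝ := fun i => ν i ^ 2 * y i with hxdef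
  have hx : ∀ i, 0 ≤ x i := fun i => mul_nonneg (sq_nonneg _) (hy i)
  have hX0 : 0 ≤ X := hX.nonneg hx
  have hY0 : 0 ≤ Y := hY.nonneg hy
  set q : ℕ → ℝ := fun i => if ν i = 0 then 0 else Real.exp (-(l / ν i ^ 2)) with hq
  have hq0 : ∀ i, 0 ≤ q i := fun i => by
    simp only [hq]; split_ifs
    · rfl
    · positivity
  have hqs : ∑' i, ENNReal.ofReal (q i) = ENNReal.ofReal (Z - 1) := by
    rw [hZ, add_sub_cancel_right, ENNReal.ofReal_toReal hexp, expSum]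
    refine tsum_congr fun i => ?_
    simp only [hq]; split_ifs <;> simp
  have hqS : HasSum q (Z - 1) := hasSum_of_tsum_ofReal hq0 (by linarith) hqs
  have key : ∀ i, x i * Real.log (X / x i) + x i ≤ X * q i / Z + l * y i + x i * Real.log Z := by
    intro i
    by_cases h0 : ν i = 0
    · have h1 : x i = 0 := by simp [hxdef, h0]
      have h2 : q i = 0 := by simp [hq, h0]
      simp only [h1, h2]
      have := mul_nonneg hl.le (hy i)
      simpa using this
    · have h := mul_log_div_le (hx i) (le_of_hasSum_nonneg hx hX i)
        (show 0 < Real.exp (l / ν i ^ 2) * Z by positivity)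
      have h1 : q i = Real.exp (-(l / ν i ^ 2)) := by simp [hq, h0]
      rw [Real.log_mul (by positivity) hZ0.ne', Real.log_exp] at h
      have h2 : x i * (l / ν i ^ 2) = l * y i := by
        simp only [hxdef]; field_simp
      have h3 : X / (Real.exp (l / ν i ^ 2) * Z) = X * q i / Z := by
        rw [h1, Real.exp_neg]; field_simp
      rw [h3, mul_add, h2] at h
      linarith
  have hR : HasSum (fun i => X * q i / Z + l * y i + x i * Real.log Z)
      (X * (Z - 1) / Z + l * Y + X * Real.log Z) :=
    (((hqS.mul_left X).div_const Z).add (hY.mul_left l)).add (hX.mul_right _)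
  have main : clEntropy x + ENNReal.ofReal X ≤
      ENNReal.ofReal (l * Y + X * Real.log Z) + ENNReal.ofReal X := by
    rw [clEntropy_eq hx hX, ← tsum_ofReal_of_hasSum hx hX, ← ENNReal.tsum_add]
    calc _ ≤ ∑' i, ENNReal.ofReal (X * q i / Z + l * y i + x i * Real.log Z) := by
          refine ENNReal.tsum_le_tsum fun i => ?_
          rw [← ENNReal.ofReal_add
            (mul_log_div_nonneg (hx i) (le_of_hasSum_nonneg hx hX i)) (hx i)]
          exact ENNReal.ofReal_le_ofReal (key i)
      _ = ENNReal.ofReal (X * (Z - 1) / Z + l * Y + X * Real.log Z) := by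
          refine tsum_ofReal_of_hasSum (fun i => ?_) hR
          have := hq0 i; have := hy i; have := hx i
          positivity
      _ ≤ _ := by
          rw [tsum_ofReal_of_hasSum hx hX, ← ENNReal.ofReal_add (by positivity) hX0]
          refine ENNReal.ofReal_le_ofReal ?_
          have : X * (Z - 1) / Z ≤ X := by
            rw [div_le_iff₀ hZ0]; nlinarith
          linarith
  exact (ENNReal.add_le_add_iff_right ENNReal.ofReal_ne_top).1 main

/-- The classical entropy is approximated from below by its finite truncations. -/
theorem exists_finset_lt_clEntropy {x : ι → ℝ} (hx : ∀ i, 0 ≤ x i) (hs : Summable x) {c : ℝ≥0∞}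
    (hc : c < clEntropy x) :
    ∃ s : Finset ι, (∀ i ∈ s, 0 < x i) ∧ c < clEntropy fun i => if i ∈ s then x i else 0 := by
  obtain ⟨X, hX⟩ := hs
  rw [clEntropy_eq hx hX, ENNReal.tsum_eq_iSup_sum, lt_iSup_iff] at hc
  obtain ⟨s₀, hs₀⟩ := hc
  have hlim : Tendsto (fun s : Finset ι => ∑ i ∈ s₀, ENNReal.ofReal
      (x i * Real.log ((∑ j ∈ s, x j) / x i))) atTop
      (𝓝 (∑ i ∈ s₀, ENNReal.ofReal (x i * Real.log (X / x i)))) := by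
    refine tendsto_finsetSum _ fun i _ => ENNReal.tendsto_ofReal ?_
    rcases (hx i).eq_or_lt with h | h
    · simp [← h]
    · have hXp : 0 < X := h.trans_le (le_of_hasSum_nonneg hx hX i)
      exact ((Real.continuousAt_log (by positivity)).tendsto.comp
        (Tendsto.div_const hX _)).const_mul _
  obtain ⟨s, h1, h2⟩ := ((hlim.eventually_const_lt hs₀).and (eventually_ge_atTop s₀)).exists
  refine ⟨s.filter fun i => 0 < x i, fun i hi => (Finset.mem_filter.1 hi).2, ?_⟩
  have hfun : (fun i => if i ∈ s.filter (fun i => 0 < x i) then x i else 0) =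
      fun i => if i ∈ s then x i else 0 := by
    funext i
    by_cases his : i ∈ s
    · rcases (hx i).eq_or_lt with h | h
      · simp [← h]
      · simp [his, h]
    · simp [his]
  rw [hfun]
  have hsum : HasSum (fun i => if i ∈ s then x i else 0) (∑ j ∈ s, x j) := by
    have : HasSum (fun i => if i ∈ s then x i else 0) (∑ i ∈ s, if i ∈ s then x i else 0) :=
      hasSum_sum_of_ne_finset_zero fun i hi => by simp [hi]
    rwa [Finset.sum_congr rfl (fun i hi => by rw [if_pos hi])] at this
  rw [clEntropy_eq (fun i => by split_ifs <;> simp [hx]) hsum]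
  refine h1.trans_le (le_trans ?_ (ENNReal.sum_le_tsum s₀))
  refine Finset.sum_le_sum fun i hi => ?_
  rw [if_pos (h2 hi)]

end ClassicalEntropy

section Trace

variable {E F : Type*} {ι κ : Type*}
variable [NormedAddCommGroup E] [InnerProductSpace ℂ E] [CompleteSpace E]
variable [NormedAddCommGroup F] [InnerProductSpace ℂ F] [CompleteSpace F]

open scoped InnerProductSpace

theorem inner_mul_inner_flip (x y : E) : ⟪x, y⟫_ℂ * ⟪y, x⟫_ℂ = ((‖⟪y, x⟫_ℂ‖ ^ 2 : ℝ) : ℂ) := by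
  rw [← inner_conj_symm x y, Complex.conj_mul']
  norm_cast

theorem hasSum_sq_inner (b : HilbertBasis ι ℂ E) (x : E) :
    HasSum (fun i => ‖⟪b i, x⟫_ℂ‖ ^ 2) (‖x‖ ^ 2) := by
  have h := b.hasSum_inner_mul_inner x x
  simp_rw [inner_mul_inner_flip] at h
  rw [inner_self_eq_norm_sq_to_K] at h
  refine Complex.hasSum_ofReal.1 ?_
  simpa using h

theorem tsum_sq_inner_eq (b : HilbertBasis ι ℂ E) (x : E) :
    ∑' i, ENNReal.ofReal (‖⟪b i, x⟫_ℂ‖ ^ 2) = ENNReal.ofReal (‖x‖ ^ 2) := by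
  exact tsum_ofReal_of_hasSum (fun i => by positivity) (hasSum_sq_inner b x)

theorem tsum_sq_inner_le {v : ι → E} (hv : Orthonormal ℂ v) (x : E) :
    ∑' i, ENNReal.ofReal (‖⟪v i, x⟫_ℂ‖ ^ 2) ≤ ENNReal.ofReal (‖x‖ ^ 2) := by
  rw [ENNReal.tsum_eq_iSup_sum]
  refine iSup_le fun s => ?_
  rw [← ENNReal.ofReal_sum_of_nonneg fun i _ => by positivity]
  exact ENNReal.ofReal_le_ofReal (hv.sum_inner_products_le x)

theorem tsum_sq_norm_eq_adjoint (T : E →L[ℂ] F) (b : HilbertBasis ι ℂ E)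
    (c : HilbertBasis κ ℂ F) :
    ∑' i, ENNReal.ofReal (‖T (b i)‖ ^ 2) =
      ∑' k, ENNReal.ofReal (‖ContinuousLinearMap.adjoint T (c k)‖ ^ 2) := by
  simp_rw [← tsum_sq_inner_eq c, ← tsum_sq_inner_eq b]
  rw [ENNReal.tsum_comm]
  refine tsum_congr fun k => tsum_congr fun i => ?_
  rw [ContinuousLinearMap.adjoint_inner_right, norm_inner_symm]

theorem tsum_sq_norm_le_adjoint (T : E →L[ℂ] F) {v : ι → E} (hv : Orthonormal ℂ v)
    (c : HilbertBasis κ ℂ F) :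
    ∑' i, ENNReal.ofReal (‖T (v i)‖ ^ 2) ≤
      ∑' k, ENNReal.ofReal (‖ContinuousLinearMap.adjoint T (c k)‖ ^ 2) := by
  simp_rw [← tsum_sq_inner_eq c]
  rw [ENNReal.tsum_comm]
  refine ENNReal.tsum_le_tsum fun k => le_trans (le_of_eq (tsum_congr fun i => ?_))
    (tsum_sq_inner_le hv _)
  rw [ContinuousLinearMap.adjoint_inner_right, norm_inner_symm]

/-- A positive square root, packaged through the identities that are used about it. -/
theorem exists_sqrt {A : E →L[ℂ] E} (hA : A.IsPositive) :
    ∃ R : E →L[ℂ] E, ContinuousLinearMap.adjoint R = R ∧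
      (∀ x y, ⟪x, A y⟫_ℂ = ⟪R x, R y⟫_ℂ) ∧ ∀ x, qf A x = ‖R x‖ ^ 2 := by
  have hA' : (0 : E →L[ℂ] E) ≤ A := (ContinuousLinearMap.nonneg_iff_isPositive A).2 hA
  have hR := (ContinuousLinearMap.nonneg_iff_isPositive _).1 (CFC.sqrt_nonneg A)
  have hadj : ContinuousLinearMap.adjoint (CFC.sqrt A) = CFC.sqrt A := hR.isSelfAdjoint.adjoint_eq
  have hi : ∀ x y, ⟪x, A y⟫_ℂ = ⟪CFC.sqrt A x, CFC.sqrt A y⟫_ℂ := fun x y => by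
    conv_lhs => rw [← CFC.sqrt_mul_sqrt_self A hA']
    rw [mul_apply_eq_comp, ← ContinuousLinearMap.adjoint_inner_left, hadj]
  refine ⟨CFC.sqrt A, hadj, hi, fun x => ?_⟩
  rw [qf, hi, inner_self_eq_norm_sq_to_K]
  norm_cast

theorem qf_nonneg {A : E →L[ℂ] E} (hA : A.IsPositive) (x : E) : 0 ≤ qf A x := by
  obtain ⟨R, -, -, h⟩ := exists_sqrt hA
  rw [h]; positivity

theorem traceENN_eq {A : E →L[ℂ] E} (hA : A.IsPositive) (b : HilbertBasis ι ℂ E) :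
    traceENN A = ∑' i, ENNReal.ofReal (qf A (b i)) := by
  obtain ⟨R, hR, -, hq⟩ := exists_sqrt hA
  refine le_antisymm ?_ ?_
  · refine iSup_le fun n => iSup_le fun e => iSup_le fun he => ?_
    simp_rw [hq]
    rw [← tsum_fintype (L := .unconditional _)]
    have := tsum_sq_norm_le_adjoint R he b
    rwa [hR] at this
  · rw [ENNReal.tsum_eq_iSup_sum]
    refine iSup_le fun s => ?_
    have hs : Orthonormal ℂ fun i : Fin s.card => b (s.equivFin.symm i) :=
      b.orthonormal.comp _ (Subtype.val_injective.comp s.equivFin.symm.injective)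
    refine le_trans (le_of_eq ?_) (le_iSup_of_le s.card (le_iSup_of_le _ (le_iSup_of_le hs le_rfl)))
    rw [← s.sum_coe_sort fun i => ENNReal.ofReal (qf A (b i))]
    exact (s.equivFin.symm.sum_comp fun i : s => ENNReal.ofReal (qf A (b i))).symm

/-- Positive operators of finite trace. -/
def PosTrace (A : E →L[ℂ] E) : Prop := A.IsPositive ∧ traceENN A ≠ ∞

theorem traceENN_le_traceNorm (A : E →L[ℂ] E) : traceENN A ≤ traceNorm A := by
  refine iSup_le fun n => iSup_le fun e => iSup_le fun he => ?_
  refine le_trans (Finset.sum_le_sum fun i _ => ?_) (le_iSup_of_le n (le_iSup_of_le e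
    (le_iSup_of_le e (le_iSup_of_le he (le_iSup_of_le he le_rfl)))))
  exact ENNReal.ofReal_le_ofReal (Complex.re_le_norm _)

theorem PosTrace.of_mem_posTC {A : E →L[ℂ] E} (hA : A ∈ posTC E) : PosTrace A :=
  ⟨hA.1, ((traceENN_le_traceNorm A).trans_lt hA.2.lt_top).ne⟩

theorem PosTrace.isTC {A : E →L[ℂ] E} (hA : PosTrace A) : IsTC A := by
  obtain ⟨R, hR, hi, hq⟩ := exists_sqrt hA.1
  have hb : ∀ (n : ℕ) (e : Fin n → E), Orthonormal ℂ e →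
      ∑ i, ENNReal.ofReal (‖R (e i)‖ ^ 2) ≤ traceENN A := fun n e he => by
    simp_rw [← hq]
    exact le_iSup_of_le n (le_iSup_of_le _ (le_iSup_of_le he le_rfl))
  refine ne_top_of_le_ne_top (ENNReal.add_ne_top.2 ⟨hA.2, hA.2⟩)
    (iSup_le fun n => iSup_le fun e => iSup_le fun f => iSup_le fun he => iSup_le fun hf => ?_)
  refine le_trans ?_ (add_le_add (hb n e he) (hb n f hf))
  rw [← Finset.sum_add_distrib]
  refine Finset.sum_le_sum fun i _ => ?_
  rw [← ENNReal.ofReal_add (by positivity) (by positivity), hi]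
  refine ENNReal.ofReal_le_ofReal ((norm_inner_le_norm _ _).trans ?_)
  nlinarith [sq_nonneg (‖R (e i)‖ - ‖R (f i)‖), sq_nonneg (‖R (e i)‖), sq_nonneg (‖R (f i)‖)]

theorem PosTrace.hasSum_qf {A : E →L[ℂ] E} (hA : PosTrace A) (b : HilbertBasis ι ℂ E) :
    HasSum (fun i => qf A (b i)) (traceENN A).toReal := by
  refine hasSum_of_tsum_ofReal (fun i => qf_nonneg hA.1 _) ENNReal.toReal_nonneg ?_
  rw [ENNReal.ofReal_toReal hA.2, traceENN_eq hA.1 b]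

/-- `A = ∑ₖ |φₖ⟩⟨φₖ|`, expressed through quadratic forms. -/
def Generates (φ : κ → E) (A : E →L[ℂ] E) : Prop :=
  ∀ x, HasSum (fun k => ‖⟪φ k, x⟫_ℂ‖ ^ 2) (qf A x)

theorem inner_rankOne (φ x y : E) : ⟪x, rankOne φ y⟫_ℂ = ⟪x, φ⟫_ℂ * ⟪φ, y⟫_ℂ := by
  simp [rankOne, mul_comm]

theorem isCompactOperator_rankOne (φ : E) : IsCompactOperator (rankOne φ) := by
  have h : (rankOne φ : E → E) = fun x => (ContinuousLinearMap.toSpanSingleton ℂ φ) (innerSL ℂ φ x) := by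
    funext x; simp [rankOne]
  rw [h]
  exact (isCompactOperator_of_locallyCompactSpace_rng
    (ContinuousLinearMap.toSpanSingleton ℂ φ)).comp_clm (innerSL ℂ φ)

theorem exists_op_of_summable {φ : κ → E} (h : Summable fun k => ‖φ k‖ ^ 2) :
    ∃ A : E →L[ℂ] E, PosTrace A ∧ IsCompactOperator A ∧ Generates φ A ∧
      ∀ x y, HasSum (fun k => ⟪x, φ k⟫_ℂ * ⟪φ k, y⟫_ℂ) ⟪x, A y⟫_ℂ := by
  have hs : Summable fun k => rankOne (φ k) := by
    refine Summable.of_norm_bounded h fun k => ?_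
    rw [rankOne, ContinuousLinearMap.norm_smulRight_apply, innerSL_apply_norm, sq]
  obtain ⟨A, hA⟩ := hs
  have hi : ∀ x y, HasSum (fun k => ⟪x, φ k⟫_ℂ * ⟪φ k, y⟫_ℂ) ⟪x, A y⟫_ℂ := fun x y => by
    have := hA.mapL ((innerSL ℂ x).comp (ContinuousLinearMap.apply ℂ E y))
    simpa [inner_rankOne] using this
  have hg : Generates φ A := fun x => by
    have := (hi x x).mapL Complex.reCLM
    simp_rw [inner_mul_inner_flip] at this
    exact this
  have hpos : A.IsPositive := by
    refine (ContinuousLinearMap.isPositive_iff_complex A).2 fun x => ?_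
    have hr : ⟪x, A x⟫_ℂ = ((qf A x : ℝ) : ℂ) := by
      have := hi x x
      simp_rw [inner_mul_inner_flip] at this
      exact this.unique (Complex.hasSum_ofReal.2 (hg x))
    rw [← inner_conj_symm, hr, Complex.conj_ofReal]
    exact ⟨by simp, by simpa using (hg x).nonneg fun k => by positivity⟩
  refine ⟨A, ⟨hpos, ?_⟩, ?_, hg, hi⟩
  · obtain ⟨w, b, -⟩ := exists_hilbertBasis ℂ E
    rw [traceENN_eq hpos b]
    have : ∀ i, ENNReal.ofReal (qf A (b i)) = ∑' k, ENNReal.ofReal (‖⟪b i, φ k⟫_ℂ‖ ^ 2) :=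
      fun i => by
        rw [← tsum_ofReal_of_hasSum (fun k => by positivity) (hg (b i))]
        simp_rw [norm_inner_symm]
    simp_rw [this]
    rw [ENNReal.tsum_comm]
    simp_rw [tsum_sq_inner_eq]
    rw [tsum_ofReal_of_hasSum (fun k => by positivity) h.hasSum]
    exact ENNReal.ofReal_ne_top
  · exact isCompactOperator_of_tendsto hA (Eventually.of_forall fun s =>
      sum_mem (S := compactOperator (RingHom.id ℂ) E E) fun k _ => isCompactOperator_rankOne (φ k))

end Trace

section Eigen

universe u
variable {E : Type u} {F : Type*} {ι κ : Type*}
variable [NormedAddCommGroup E] [InnerProductSpace ℂ E] [CompleteSpace E]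
variable [NormedAddCommGroup F] [InnerProductSpace ℂ F] [CompleteSpace F]

open scoped InnerProductSpace

theorem inner_adjoint_eq_self {R : E →L[ℂ] E} (hR : ContinuousLinearMap.adjoint R = R)
    (x y : E) : ⟪R x, y⟫_ℂ = ⟪x, R y⟫_ℂ := by
  rw [← ContinuousLinearMap.adjoint_inner_right, hR]

theorem PosTrace.isCompactOperator {A : E →L[ℂ] E} (hA : PosTrace A) : IsCompactOperator A := by
  obtain ⟨R, hR, hi, hq⟩ := exists_sqrt hA.1
  obtain ⟨w, b, -⟩ := exists_hilbertBasis ℂ E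
  have hs : Summable fun i => ‖R (b i)‖ ^ 2 := by
    simp_rw [← hq]
    exact (hA.hasSum_qf b).summable
  obtain ⟨B, -, hB, -, hB'⟩ := exists_op_of_summable hs
  have : A = B := by
    refine ContinuousLinearMap.ext fun y => ext_inner_left ℂ fun x => ?_
    refine HasSum.unique ?_ (hB' x y)
    rw [hi]
    simpa only [inner_adjoint_eq_self hR] using b.hasSum_inner_mul_inner (R x) (R y)
  rwa [this]

/-- The basis `e` diagonalizes `A` with eigenvalues `lam`. -/
def IsEigenbasis (A : E →L[ℂ] E) (e : HilbertBasis ι ℂ E) (lam : ι → ℝ) : Prop :=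
  ∀ i, A (e i) = (lam i : ℂ) • e i

theorem exists_isEigenbasis_of_isCompactOperator {A : E →L[ℂ] E} (hc : IsCompactOperator A)
    (hs : (A : E →ₗ[ℂ] E).IsSymmetric) :
    ∃ (ι : Type u) (e : HilbertBasis ι ℂ E) (lam : ι → ℝ), IsEigenbasis A e lam := by
  have hcl : ∀ μ : ℂ, CompleteSpace (Module.End.eigenspace (A : E →ₗ[ℂ] E) μ) := fun μ => by
    refine IsClosed.completeSpace_coe (hs := ?_)
    have : (Module.End.eigenspace (A : E →ₗ[ℂ] E) μ : Set E) = {x | A x = μ • x} := by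
      ext x; simp
    rw [this]
    exact isClosed_eq A.continuous (continuous_const_smul μ)
  choose w b hb using fun μ : ℂ =>
    exists_hilbertBasis ℂ (Module.End.eigenspace (A : E →ₗ[ℂ] E) μ)
  have hon : Orthonormal ℂ fun a : Σ μ : ℂ, w μ => ((b a.1 a.2 :
      Module.End.eigenspace (A : E →ₗ[ℂ] E) a.1) : E) :=
    hs.orthogonalFamily_eigenspaces.orthonormal_sigma_orthonormal fun μ => (b μ).orthonormal
  have hbot : (Submodule.span ℂ (Set.range fun a : Σ μ : ℂ, w μ => ((b a.1 a.2 :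
      Module.End.eigenspace (A : E →ₗ[ℂ] E) a.1) : E)))ᗮ = ⊥ := by
    have h0 := ContinuousLinearMap.orthogonalComplement_iSup_eigenspaces_eq_bot hc hs
    rw [eq_bot_iff, ← h0]
    intro x hx
    rw [Submodule.mem_orthogonal] at hx
    rw [← Submodule.iInf_orthogonal, Submodule.mem_iInf]
    intro μ
    rw [Submodule.mem_orthogonal]
    intro y hy
    have h1 : ∀ i, ⟪((b μ i : Module.End.eigenspace (A : E →ₗ[ℂ] E) μ) : E), x⟫_ℂ = 0 :=
      fun i => hx _ (Submodule.subset_span ⟨⟨μ, i⟩, rfl⟩)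
    have h2 := ((b μ).hasSum_repr ⟨y, hy⟩).mapL
      ((innerSL ℂ x).comp (Submodule.subtypeL _))
    have h3 : ∀ i, ⟪x, ((b μ i : Module.End.eigenspace (A : E →ₗ[ℂ] E) μ) : E)⟫_ℂ = 0 :=
      fun i => by rw [← inner_conj_symm, h1, map_zero]
    have h4 : ⟪x, y⟫_ℂ = 0 := by
      refine HasSum.unique (by simpa using h2) ?_
      simp [h3]
    rw [← inner_conj_symm, h4, map_zero]
  refine ⟨_, HilbertBasis.mkOfOrthogonalEqBot hon hbot, fun a => a.1.re, fun a => ?_⟩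
  have hne : ((b a.1 a.2 : Module.End.eigenspace (A : E →ₗ[ℂ] E) a.1) : E) ≠ 0 := by
    have := hon.ne_zero a
    exact this
  have hev : A ((b a.1 a.2 : Module.End.eigenspace (A : E →ₗ[ℂ] E) a.1) : E) =
      a.1 • ((b a.1 a.2 : Module.End.eigenspace (A : E →ₗ[ℂ] E) a.1) : E) :=
    Module.End.mem_eigenspace_iff.1 (b a.1 a.2).2
  have hreal : ((a.1.re : ℝ) : ℂ) = a.1 := by
    refine Complex.conj_eq_iff_re.1 (hs.conj_eigenvalue_eq_self (T := (A : E →ₗ[ℂ] E)) ?_)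
    exact Module.End.hasEigenvalue_of_hasEigenvector
      (Module.End.hasEigenvector_iff.2 ⟨(b a.1 a.2).2, hne⟩)
  rw [HilbertBasis.coe_mkOfOrthogonalEqBot, hreal]
  exact hev

theorem PosTrace.exists_isEigenbasis {A : E →L[ℂ] E} (hA : PosTrace A) :
    ∃ (ι : Type u) (e : HilbertBasis ι ℂ E) (lam : ι → ℝ), IsEigenbasis A e lam :=
  exists_isEigenbasis_of_isCompactOperator hA.isCompactOperator hA.1.isSymmetric

theorem IsEigenbasis.qf_apply {A : E →L[ℂ] E} {e : HilbertBasis ι ℂ E} {lam : ι → ℝ}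
    (h : IsEigenbasis A e lam) (i : ι) : qf A (e i) = lam i := by
  rw [qf, h, inner_smul_right, inner_self_eq_norm_sq_to_K, e.orthonormal.1 i]
  simp

theorem IsEigenbasis.hasSum {A : E →L[ℂ] E} {e : HilbertBasis ι ℂ E} {lam : ι → ℝ}
    (h : IsEigenbasis A e lam) (hA : PosTrace A) : HasSum lam (traceENN A).toReal := by
  simpa only [h.qf_apply] using hA.hasSum_qf e

theorem IsEigenbasis.nonneg {A : E →L[ℂ] E} {e : HilbertBasis ι ℂ E} {lam : ι → ℝ}
    (h : IsEigenbasis A e lam) (hA : PosTrace A) (i : ι) : 0 ≤ lam i := by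
  rw [← h.qf_apply]
  exact qf_nonneg hA.1 _

/-- The spectral decomposition of the quadratic form. -/
theorem IsEigenbasis.hasSum_mul_sq {A : E →L[ℂ] E} {e : HilbertBasis ι ℂ E} {lam : ι → ℝ}
    (h : IsEigenbasis A e lam) (hs : (A : E →ₗ[ℂ] E).IsSymmetric) (x : E) :
    HasSum (fun i => lam i * ‖⟪e i, x⟫_ℂ‖ ^ 2) (qf A x) := by
  have h1 := (e.hasSum_inner_mul_inner x (A x)).mapL Complex.reCLM
  have h2 : ∀ i, ⟪e i, A x⟫_ℂ = lam i * ⟪e i, x⟫_ℂ := fun i => by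
    have := hs (e i) x
    simp only [ContinuousLinearMap.coe_coe] at this
    rw [← this, h, inner_smul_left, Complex.conj_ofReal]
  have h3 : ∀ i, ⟪x, e i⟫_ℂ * ⟪e i, A x⟫_ℂ = ((lam i * ‖⟪e i, x⟫_ℂ‖ ^ 2 : ℝ) : ℂ) := fun i => by
    rw [h2, mul_left_comm, inner_mul_inner_flip]
    push_cast
    rfl
  simp_rw [h3] at h1
  exact h1

theorem IsEigenbasis.generates {A : E →L[ℂ] E} {e : HilbertBasis ι ℂ E} {lam : ι → ℝ}
    (h : IsEigenbasis A e lam) (hA : PosTrace A) :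
    Generates (fun i => (√(lam i) : ℂ) • e i) A := fun x => by
  convert h.hasSum_mul_sq hA.1.isSymmetric x using 2 with i
  rw [inner_smul_left, Complex.conj_ofReal, norm_mul, Complex.norm_real, mul_pow,
    Real.norm_of_nonneg (Real.sqrt_nonneg _), Real.sq_sqrt (h.nonneg hA i)]

theorem Generates.tsum_norm_sq {φ : κ → E} {A : E →L[ℂ] E} (h : Generates φ A)
    (hA : A.IsPositive) : ∑' k, ENNReal.ofReal (‖φ k‖ ^ 2) = traceENN A := by
  obtain ⟨w, b, -⟩ := exists_hilbertBasis ℂ E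
  simp_rw [← tsum_sq_inner_eq b]
  rw [ENNReal.tsum_comm, traceENN_eq hA b]
  refine tsum_congr fun i => ?_
  rw [← tsum_ofReal_of_hasSum (fun k => by positivity) (h (b i))]
  simp_rw [norm_inner_symm]

theorem Generates.hasSum_norm_sq {φ : κ → E} {A : E →L[ℂ] E} (h : Generates φ A)
    (hA : PosTrace A) : HasSum (fun k => ‖φ k‖ ^ 2) (traceENN A).toReal := by
  refine hasSum_of_tsum_ofReal (fun k => by positivity) ENNReal.toReal_nonneg ?_
  rw [ENNReal.ofReal_toReal hA.2, h.tsum_norm_sq hA.1]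

theorem Generates.sum_sq_div_le {φ : κ → E} {A : E →L[ℂ] E} (h : Generates φ A)
    {e : HilbertBasis ι ℂ E} {lam : ι → ℝ} (he : IsEigenbasis A e lam)
    (k : κ) (J : Finset ι) : ∑ j ∈ J, ‖⟪φ k, e j⟫_ℂ‖ ^ 2 / lam j ≤ 1 := by
  set Y := ∑ j ∈ J, ‖⟪φ k, e j⟫_ℂ‖ ^ 2 / lam j with hY
  set c : ι → ℂ := fun j => ⟪e j, φ k⟫_ℂ / lam j with hc
  set x := ∑ j ∈ J, c j • e j with hx
  have h1 : ⟪φ k, x⟫_ℂ = (Y : ℂ) := by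
    rw [hx, inner_sum, hY]
    push_cast
    refine Finset.sum_congr rfl fun j _ => ?_
    rw [inner_smul_right, hc]
    have := inner_mul_inner_flip (e j) (φ k)
    push_cast at this
    rw [← this]
    ring
  have h2 : A x = ∑ j ∈ J, (c j * lam j) • e j := by
    rw [hx, map_sum]
    refine Finset.sum_congr rfl fun j _ => ?_
    rw [map_smul, he, smul_smul]
  have h3 : qf A x = Y := by
    rw [qf, h2, hx, e.orthonormal.inner_sum, hY, Complex.re_sum]
    refine Finset.sum_congr rfl fun j _ => ?_
    rcases eq_or_ne (lam j) 0 with h0 | h0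
    · simp [h0]
    · have h5 : (lam j : ℂ) ≠ 0 := by exact_mod_cast h0
      have : (starRingEnd ℂ) (c j) * (c j * lam j) = ((‖⟪φ k, e j⟫_ℂ‖ ^ 2 / lam j : ℝ) : ℂ) := by
        have h4 := inner_mul_inner_flip (e j) (φ k)
        push_cast at h4 ⊢
        rw [← h4, hc]
        simp only [map_div₀, Complex.conj_ofReal, inner_conj_symm]
        field_simp
      rw [this, Complex.ofReal_re]
  have h4 : ‖⟪φ k, x⟫_ℂ‖ ^ 2 ≤ qf A x := le_of_hasSum_nonneg (fun k => by positivity) (h x) k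
  rw [h1, h3, Complex.norm_real, Real.norm_eq_abs, sq_abs] at h4
  nlinarith

/-- Among all generating families of `A` the eigenvectors have the least entropy. -/
theorem Generates.clEntropy_le {φ : κ → E} {A : E →L[ℂ] E} (h : Generates φ A)
    {e : HilbertBasis ι ℂ E} {lam : ι → ℝ} (he : IsEigenbasis A e lam) (hA : PosTrace A) :
    clEntropy lam ≤ clEntropy fun k => ‖φ k‖ ^ 2 := by
  set T := (traceENN A).toReal with hT
  have hp := h.hasSum_norm_sq hA
  have hl := he.hasSum hA
  have hl0 := he.nonneg hA
  rw [clEntropy_eq hl0 hl, clEntropy_eq (fun k => by positivity) hp]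
  have hlT : ∀ j, lam j ≤ T := le_of_hasSum_nonneg hl0 hl
  have hpT : ∀ k, ‖φ k‖ ^ 2 ≤ T := le_of_hasSum_nonneg (fun k => by positivity) hp
  set w : ι → κ → ℝ := fun j k => ‖⟪φ k, e j⟫_ℂ‖ ^ 2 / lam j with hw
  have hw0 : ∀ j k, 0 ≤ w j k := fun j k => div_nonneg (by positivity) (hl0 j)
  have hcol : ∀ j, HasSum (fun k => ‖⟪φ k, e j⟫_ℂ‖ ^ 2) (lam j) := fun j => by
    have := h (e j)
    rwa [he.qf_apply] at this
  have hmul : ∀ j k, w j k * lam j = ‖⟪φ k, e j⟫_ℂ‖ ^ 2 := fun j k => by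
    rcases eq_or_ne (lam j) 0 with h0 | h0
    · have h1 := le_of_hasSum_nonneg (fun k => by positivity) (hcol j) k
      rw [h0] at h1 ⊢
      rw [mul_zero]
      exact le_antisymm (by positivity) h1
    · rw [hw]; field_simp
  have hrow : ∀ k, ∑' j, ENNReal.ofReal (w j k) ≤ 1 := fun k => by
    rw [ENNReal.tsum_eq_iSup_sum]
    refine iSup_le fun J => ?_
    rw [← ENNReal.ofReal_sum_of_nonneg fun j _ => hw0 j k, ← ENNReal.ofReal_one]
    exact ENNReal.ofReal_le_ofReal (h.sum_sq_div_le he k J)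
  have hpt : ∀ j k, ENNReal.ofReal (w j k * (lam j * Real.log (T / lam j))) +
      ENNReal.ofReal (‖⟪φ k, e j⟫_ℂ‖ ^ 2) ≤
      ENNReal.ofReal (‖⟪φ k, e j⟫_ℂ‖ ^ 2 * Real.log (T / ‖φ k‖ ^ 2)) +
        ENNReal.ofReal (w j k * ‖φ k‖ ^ 2) := fun j k => by
    have hg := mul_log_div_nonneg (hl0 j) (hlT j)
    rcases eq_or_ne (φ k) 0 with h0 | h0
    · have : w j k = 0 := by simp [hw, h0]
      simp [this, h0]
    have hk : 0 < ‖φ k‖ ^ 2 := by positivity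
    have hT0 : 0 < T := hk.trans_le (hpT k)
    have hlog : 0 ≤ Real.log (T / ‖φ k‖ ^ 2) := Real.log_nonneg (by rw [le_div_iff₀ hk]; linarith [hpT k])
    have := mul_log_div_le (hl0 j) (hlT j) (div_pos hT0 hk)
    rw [div_div_cancel₀ hT0.ne'] at this
    rw [← ENNReal.ofReal_add (mul_nonneg (hw0 j k) hg) (by positivity),
      ← ENNReal.ofReal_add (by positivity) (mul_nonneg (hw0 j k) hk.le), ← hmul]
    refine ENNReal.ofReal_le_ofReal ?_
    nlinarith [mul_le_mul_of_nonneg_left this (hw0 j k)]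
  have hsum := ENNReal.tsum_le_tsum fun j => ENNReal.tsum_le_tsum fun k => hpt j k
  simp_rw [ENNReal.tsum_add] at hsum
  have e1 : ∑' j, ∑' k, ENNReal.ofReal (w j k * (lam j * Real.log (T / lam j))) =
      ∑' j, ENNReal.ofReal (lam j * Real.log (T / lam j)) := by
    refine tsum_congr fun j => ?_
    rcases eq_or_ne (lam j) 0 with h0 | h0
    · simp [h0]
    refine tsum_ofReal_of_hasSum
      (fun k => mul_nonneg (hw0 j k) (mul_log_div_nonneg (hl0 j) (hlT j))) ?_
    have := ((hcol j).div_const (lam j)).mul_right (lam j * Real.log (T / lam j))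
    rwa [div_self h0, one_mul] at this
  have e2 : ∑' j, ∑' k, ENNReal.ofReal (‖⟪φ k, e j⟫_ℂ‖ ^ 2) = ENNReal.ofReal T := by
    simp_rw [fun j => tsum_ofReal_of_hasSum (fun k => by positivity) (hcol j)]
    exact tsum_ofReal_of_hasSum hl0 hl
  have hflip : ∀ k, ∑' j, ENNReal.ofReal (‖⟪φ k, e j⟫_ℂ‖ ^ 2) = ENNReal.ofReal (‖φ k‖ ^ 2) :=
    fun k => by
      rw [← tsum_sq_inner_eq e]
      simp_rw [norm_inner_symm]
  have e3 : ∑' j, ∑' k, ENNReal.ofReal (‖⟪φ k, e j⟫_ℂ‖ ^ 2 * Real.log (T / ‖φ k‖ ^ 2)) =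
      ∑' k, ENNReal.ofReal (‖φ k‖ ^ 2 * Real.log (T / ‖φ k‖ ^ 2)) := by
    rw [ENNReal.tsum_comm]
    refine tsum_congr fun k => ?_
    simp_rw [fun j => ENNReal.ofReal_mul (q := Real.log (T / ‖φ k‖ ^ 2))
      (show 0 ≤ ‖⟪φ k, e j⟫_ℂ‖ ^ 2 by positivity)]
    rw [ENNReal.tsum_mul_right, hflip, ENNReal.ofReal_mul (by positivity)]
  have e4 : ∑' j, ∑' k, ENNReal.ofReal (w j k * ‖φ k‖ ^ 2) ≤ ENNReal.ofReal T := by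
    rw [ENNReal.tsum_comm, ← tsum_ofReal_of_hasSum (fun k => by positivity) hp]
    refine ENNReal.tsum_le_tsum fun k => ?_
    simp_rw [fun j => ENNReal.ofReal_mul (q := ‖φ k‖ ^ 2) (hw0 j k)]
    rw [ENNReal.tsum_mul_right]
    exact mul_le_of_le_one_left (by positivity) (hrow k)
  rw [e1, e2, e3] at hsum
  exact (ENNReal.add_le_add_iff_right ENNReal.ofReal_ne_top).1 (hsum.trans (add_le_add le_rfl e4))

theorem IsONB.exists_hilbertBasis {s : Set E} (hs : IsONB s) :
    ∃ b : HilbertBasis s ℂ E, ∀ v : s, b v = v := by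
  have : ⊤ ≤ (Submodule.span ℂ (Set.range ((↑) : s → E))).topologicalClosure := by
    rw [Subtype.range_coe]
    exact ((Submodule.dense_iff_topologicalClosure_eq_top).1 hs.2).ge
  exact ⟨HilbertBasis.mk hs.1 this, fun v => by rw [HilbertBasis.coe_mk]⟩

theorem isONB_range (b : HilbertBasis ι ℂ E) : IsONB (Set.range b) :=
  ⟨b.orthonormal.toSubtypeRange, (Submodule.dense_iff_topologicalClosure_eq_top).2 b.dense_span⟩

theorem generates_sqrt {A R : E →L[ℂ] E} (hR : ContinuousLinearMap.adjoint R = R)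
    (hq : ∀ x, qf A x = ‖R x‖ ^ 2) (b : HilbertBasis ι ℂ E) :
    Generates (fun i => R (b i)) A := fun x => by
  rw [hq]
  convert hasSum_sq_inner b (R x) using 3 with i
  rw [← ContinuousLinearMap.adjoint_inner_right, hR]

theorem IsEigenbasis.qEntropy_eq {A : E →L[ℂ] E} {e : HilbertBasis ι ℂ E} {lam : ι → ℝ}
    (he : IsEigenbasis A e lam) (hA : PosTrace A) : qEntropy A = clEntropy lam := by
  refine le_antisymm ?_ ?_
  · refine (iInf₂_le _ (isONB_range e)).trans (le_of_eq ?_)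
    rw [← clEntropy_comp_equiv (Equiv.ofInjective e e.orthonormal.linearIndependent.injective)]
    congr 1
    funext i
    exact he.qf_apply i
  · refine le_iInf₂ fun s hs => ?_
    obtain ⟨b, hb⟩ := hs.exists_hilbertBasis
    obtain ⟨R, hR, -, hq⟩ := exists_sqrt hA.1
    have := (generates_sqrt hR hq b).clEntropy_le he hA
    simpa only [hq, hb] using this

theorem Generates.qEntropy_le {φ : κ → E} {A : E →L[ℂ] E} (h : Generates φ A)
    (hA : PosTrace A) : qEntropy A ≤ clEntropy fun k => ‖φ k‖ ^ 2 := by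
  obtain ⟨ι, e, lam, he⟩ := hA.exists_isEigenbasis
  rw [he.qEntropy_eq hA]
  exact h.clEntropy_le he hA

theorem qEntropy_mono {A B : E →L[ℂ] E} (hA : PosTrace A) (hB : PosTrace B)
    (h : ∀ x, qf A x ≤ qf B x) : qEntropy A ≤ qEntropy B := by
  refine le_iInf₂ fun s hs => (iInf₂_le s hs).trans ?_
  obtain ⟨b, hb⟩ := hs.exists_hilbertBasis
  refine clEntropy_mono (fun v => qf_nonneg hA.1 _) (fun v => h v) ?_
  simpa only [hb] using (hB.hasSum_qf b).summable

end Eigen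

section Semicontinuity

universe u
variable {E : Type u} {F : Type*} {ι κ : Type*}
variable [NormedAddCommGroup E] [InnerProductSpace ℂ E] [CompleteSpace E]
variable [NormedAddCommGroup F] [InnerProductSpace ℂ F] [CompleteSpace F]

open scoped InnerProductSpace

/-- The operator `T A T*`. -/
def conj (T : E →L[ℂ] F) (A : E →L[ℂ] E) : F →L[ℂ] F :=
  T ∘L A ∘L ContinuousLinearMap.adjoint T

theorem qf_conj (T : E →L[ℂ] F) (A : E →L[ℂ] E) (x : F) :
    qf (conj T A) x = qf A (ContinuousLinearMap.adjoint T x) := by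
  simp only [qf, conj, ContinuousLinearMap.comp_apply]
  rw [← ContinuousLinearMap.adjoint_inner_left]

theorem Generates.conj {φ : κ → E} {A : E →L[ℂ] E} (h : Generates φ A) (T : E →L[ℂ] F) :
    Generates (fun k => T (φ k)) (conj T A) := fun x => by
  rw [qf_conj]
  simpa only [ContinuousLinearMap.adjoint_inner_right] using
    h (ContinuousLinearMap.adjoint T x)

theorem PosTrace.exists_generates {A : E →L[ℂ] E} (hA : PosTrace A) :
    ∃ (κ : Type u) (φ : κ → E), Generates φ A ∧ qEntropy A = clEntropy fun k => ‖φ k‖ ^ 2 := by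
  obtain ⟨ι, e, lam, he⟩ := hA.exists_isEigenbasis
  refine ⟨ι, _, he.generates hA, ?_⟩
  rw [he.qEntropy_eq hA]
  congr 1
  funext i
  rw [norm_smul, e.orthonormal.1 i, mul_one, Complex.norm_real,
    Real.norm_of_nonneg (Real.sqrt_nonneg _), Real.sq_sqrt (he.nonneg hA i)]

theorem PosTrace.conj {A : E →L[ℂ] E} (hA : PosTrace A) (T : E →L[ℂ] F) :
    PosTrace (conj T A) := by
  obtain ⟨κ, φ, hφ, -⟩ := hA.exists_generates
  have hp : (QIT.conj T A).IsPositive := hA.1.conj_adjoint T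
  refine ⟨hp, ?_⟩
  rw [← (hφ.conj T).tsum_norm_sq hp]
  have hs := (hφ.hasSum_norm_sq hA).mul_left (‖T‖ ^ 2)
  refine ne_top_of_le_ne_top ENNReal.ofReal_ne_top (le_trans (ENNReal.tsum_le_tsum fun k => ?_)
    (tsum_ofReal_of_hasSum (fun k => by positivity) hs).le)
  refine ENNReal.ofReal_le_ofReal ?_
  rw [← mul_pow]
  exact pow_le_pow_left₀ (norm_nonneg _) (T.le_opNorm _) 2

theorem qEntropy_conj_le {A : E →L[ℂ] E} (hA : PosTrace A) {T : E →L[ℂ] F}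
    (hT : ∀ x, ‖T x‖ ≤ ‖x‖) : qEntropy (conj T A) ≤ qEntropy A := by
  obtain ⟨κ, φ, hφ, hH⟩ := hA.exists_generates
  rw [hH]
  refine ((hφ.conj T).qEntropy_le (hA.conj T)).trans (clEntropy_mono (fun k => by positivity)
    (fun k => pow_le_pow_left₀ (norm_nonneg _) (hT _) 2) (hφ.hasSum_norm_sq hA).summable)

/-- The orthogonal projection onto the span of finitely many basis vectors. -/
def basisProj (e : HilbertBasis ι ℂ E) (s : Finset ι) : E →L[ℂ] E := ∑ i ∈ s, rankOne (e i)

theorem basisProj_apply (e : HilbertBasis ι ℂ E) (s : Finset ι) (x : E) :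
    basisProj e s x = ∑ i ∈ s, ⟪e i, x⟫_ℂ • e i := by
  simp [basisProj, rankOne]

theorem adjoint_basisProj (e : HilbertBasis ι ℂ E) (s : Finset ι) :
    ContinuousLinearMap.adjoint (basisProj e s) = basisProj e s := by
  refine (ContinuousLinearMap.eq_adjoint_iff _ _).2 (fun x y => ?_) |>.symm
  simp only [basisProj_apply, sum_inner, inner_sum, inner_smul_left, inner_smul_right,
    inner_conj_symm]
  exact Finset.sum_congr rfl fun i _ => mul_comm _ _

theorem inner_basisProj (e : HilbertBasis ι ℂ E) (s : Finset ι) (x : E) (i : ι) :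
    ⟪e i, basisProj e s x⟫_ℂ = if i ∈ s then ⟪e i, x⟫_ℂ else 0 := by
  rw [basisProj_apply, inner_sum]
  simp_rw [inner_smul_right, orthonormal_iff_ite.1 e.orthonormal i]
  simp

theorem basisProj_basis (e : HilbertBasis ι ℂ E) (s : Finset ι) (i : ι) :
    basisProj e s (e i) = if i ∈ s then e i else 0 := by
  rw [basisProj_apply]
  simp_rw [orthonormal_iff_ite.1 e.orthonormal]
  simp

theorem hasSum_ite_mem (s : Finset ι) (f : ι → ℝ) :
    HasSum (fun i => if i ∈ s then f i else 0) (∑ i ∈ s, f i) := by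
  have h : HasSum (fun i => if i ∈ s then f i else 0) (∑ i ∈ s, if i ∈ s then f i else 0) :=
    hasSum_sum_of_ne_finset_zero fun i hi => if_neg hi
  rwa [Finset.sum_congr rfl fun i hi => if_pos hi] at h

theorem norm_sq_basisProj (e : HilbertBasis ι ℂ E) (s : Finset ι) (x : E) :
    ‖basisProj e s x‖ ^ 2 = ∑ i ∈ s, ‖⟪e i, x⟫_ℂ‖ ^ 2 := by
  refine (hasSum_sq_inner e _).unique ?_
  convert hasSum_ite_mem s fun i => ‖⟪e i, x⟫_ℂ‖ ^ 2 using 2 with i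
  rw [inner_basisProj]
  split_ifs <;> simp

theorem norm_basisProj_le (e : HilbertBasis ι ℂ E) (s : Finset ι) (x : E) :
    ‖basisProj e s x‖ ≤ ‖x‖ := by
  refine (sq_le_sq₀ (norm_nonneg _) (norm_nonneg _)).1 ?_
  rw [norm_sq_basisProj]
  exact sum_le_hasSum s (fun i _ => by positivity) (hasSum_sq_inner e x)

/-- The operators `ρ₀` and `ρ` are `δ`-close as quadratic forms, and the trace of `ρ` exceeds
that of `ρ₀` by at most `δ`. -/
def Near (δ : ℝ) (ρ₀ ρ : E →L[ℂ] E) : Prop :=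
  (∀ x, |qf ρ x - qf ρ₀ x| ≤ δ * ‖x‖ ^ 2) ∧ (traceENN ρ).toReal ≤ (traceENN ρ₀).toReal + δ

theorem Near.mono {δ δ' : ℝ} {ρ₀ ρ : E →L[ℂ] E} (h : Near δ ρ₀ ρ) (hδ : δ ≤ δ') :
    Near δ' ρ₀ ρ :=
  ⟨fun x => (h.1 x).trans (by gcongr), h.2.trans (by gcongr)⟩

theorem exists_pos_forall_le (s : Finset ι) (f : ι → ℝ) (hf : ∀ i ∈ s, 0 < f i) :
    ∃ δ : ℝ, 0 < δ ∧ ∀ i ∈ s, δ ≤ f i := by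
  induction s using Finset.induction_on with
  | empty => exact ⟨1, one_pos, by simp⟩
  | insert a s _ ih =>
    obtain ⟨δ, h, h'⟩ := ih fun i hi => hf i (Finset.mem_insert_of_mem hi)
    refine ⟨min δ (f a), lt_min h (hf a (Finset.mem_insert_self _ _)), fun i hi => ?_⟩
    rcases Finset.mem_insert.1 hi with rfl | hi
    · exact min_le_right _ _
    · exact (min_le_left _ _).trans (h' i hi)

/-- Lower semicontinuity of the quantum entropy. -/
theorem exists_forall_le_qEntropy {ρ₀ : E →L[ℂ] E} (h₀ : PosTrace ρ₀) {c : ℝ≥0∞}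
    (hc : c < qEntropy ρ₀) : ∃ δ : ℝ, 0 < δ ∧ ∀ ρ : E →L[ℂ] E, PosTrace ρ →
      (∀ x, qf ρ₀ x - δ * ‖x‖ ^ 2 ≤ qf ρ x) → c ≤ qEntropy ρ := by
  obtain ⟨ι, e, lam, he⟩ := h₀.exists_isEigenbasis
  rw [he.qEntropy_eq h₀] at hc
  have hl0 := he.nonneg h₀
  obtain ⟨s, hs, hcs⟩ := exists_finset_lt_clEntropy hl0 (he.hasSum h₀).summable hc
  set z : ι → ℝ := fun i => if i ∈ s then lam i else 0 with hz
  obtain ⟨t, ht0, ht1, htc⟩ : ∃ t : ℝ, 0 < t ∧ t < 1 ∧ c < ENNReal.ofReal t * clEntropy z := by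
    have h1 : Tendsto (fun t : ℝ => ENNReal.ofReal t * clEntropy z) (𝓝[<] 1)
        (𝓝 (ENNReal.ofReal 1 * clEntropy z)) :=
      (ENNReal.Tendsto.mul_const (ENNReal.continuous_ofReal.tendsto 1) (Or.inl (by simp))).mono_left
        nhdsWithin_le_nhds
    rw [ENNReal.ofReal_one, one_mul] at h1
    obtain ⟨t, ht⟩ := ((h1.eventually_const_lt hcs).and
      ((eventually_nhdsWithin_of_forall fun x (hx : x ∈ Set.Iio (1 : ℝ)) => hx).and
        (nhdsWithin_le_nhds (lt_mem_nhds (zero_lt_one (α := ℝ)))))).exists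
    exact ⟨t, ht.2.2, ht.2.1, ht.1⟩
  obtain ⟨δ, hδ, hδs⟩ := exists_pos_forall_le s (fun i => (1 - t) * lam i)
    fun i hi => mul_pos (by linarith) (hs i hi)
  refine ⟨δ, hδ, fun ρ hρ hn => htc.le.trans ?_⟩
  set P := basisProj e s with hP
  set T : E →L[ℂ] E := (√t : ℂ) • P with hT
  have hTadj : ContinuousLinearMap.adjoint T = T := by
    rw [hT, map_smulₛₗ, adjoint_basisProj, Complex.conj_ofReal]
  have hsum : Summable z := (he.hasSum h₀).summable.of_nonneg_of_le
    (fun i => by simp only [hz]; split_ifs <;> simp [hl0])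
    (fun i => by simp only [hz]; split_ifs <;> simp [hl0])
  have heig : IsEigenbasis (conj T ρ₀) e fun i => t * z i := fun i => by
    have hTe : ∀ j, T (e j) = (√t : ℂ) • if j ∈ s then e j else 0 := fun j => by
      rw [hT, smul_apply, hP, basisProj_basis]
    simp only [conj, ContinuousLinearMap.comp_apply, hTadj, hTe, map_smul, hz]
    split_ifs with hi
    · rw [he, map_smul, hTe, if_pos hi, smul_smul, smul_smul,
        mul_comm, ← mul_assoc, ← Complex.ofReal_mul, Real.mul_self_sqrt ht0.le,
        ← Complex.ofReal_mul]
    · simp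
  have hσ := h₀.conj T
  calc ENNReal.ofReal t * clEntropy z = qEntropy (conj T ρ₀) := by
        rw [heig.qEntropy_eq hσ, clEntropy_const_mul ht0.le _ hsum]
        intro i; simp only [hz]; split_ifs <;> simp [hl0]
    _ ≤ qEntropy (conj P ρ) := by
        refine qEntropy_mono hσ (hρ.conj P) fun x => ?_
        rw [qf_conj, hTadj, qf_conj, hP, adjoint_basisProj, ← hP]
        refine le_trans ?_ (hn (P x))
        have h1 : HasSum (fun i => lam i * ‖⟪e i, P x⟫_ℂ‖ ^ 2)
            (∑ i ∈ s, lam i * ‖⟪e i, x⟫_ℂ‖ ^ 2) := by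
          convert hasSum_ite_mem s fun i => lam i * ‖⟪e i, x⟫_ℂ‖ ^ 2 using 2 with i
          rw [hP, inner_basisProj]
          split_ifs <;> simp
        have h2 : qf ρ₀ (P x) = ∑ i ∈ s, lam i * ‖⟪e i, x⟫_ℂ‖ ^ 2 :=
          (he.hasSum_mul_sq h₀.1.isSymmetric (P x)).unique h1
        have h3 : qf ρ₀ (T x) = t * qf ρ₀ (P x) := by
          simp only [hT, qf, smul_apply, map_smul, inner_smul_left,
            inner_smul_right, Complex.conj_ofReal]
          rw [← mul_assoc, ← Complex.ofReal_mul, Real.mul_self_sqrt ht0.le, Complex.re_ofReal_mul]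
        rw [h3, h2, hP, norm_sq_basisProj, Finset.mul_sum, Finset.mul_sum,
          ← Finset.sum_sub_distrib]
        refine Finset.sum_le_sum fun i hi => ?_
        nlinarith [hδs i hi, sq_nonneg ‖⟪e i, x⟫_ℂ‖]
    _ ≤ qEntropy ρ := qEntropy_conj_le hρ (norm_basisProj_le e s)

theorem exists_forall_sub_le_qEntropy {ρ₀ : E →L[ℂ] E} (h₀ : PosTrace ρ₀)
    (hfin : qEntropy ρ₀ ≠ ∞) {ε : ℝ} (hε : 0 < ε) :
    ∃ δ : ℝ, 0 < δ ∧ ∀ ρ : E →L[ℂ] E, PosTrace ρ →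
      (∀ x, qf ρ₀ x - δ * ‖x‖ ^ 2 ≤ qf ρ x) → qEntropy ρ₀ - ENNReal.ofReal ε ≤ qEntropy ρ := by
  rcases eq_or_ne (qEntropy ρ₀) 0 with h0 | h0
  · exact ⟨1, one_pos, fun ρ _ _ => by simp [h0]⟩
  · exact exists_forall_le_qEntropy h₀ (ENNReal.sub_lt_self hfin h0 (by simpa using hε))

/-- Near an operator of finite entropy, small parts of the spectrum carry little entropy. -/
theorem exists_forall_clEntropy_le {ρ₀ : E →L[ℂ] E} (h₀ : PosTrace ρ₀) (hfin : qEntropy ρ₀ ≠ ∞)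
    {ε : ℝ} (hε : 0 < ε) : ∃ δ : ℝ, 0 < δ ∧ ∀ ρ : E →L[ℂ] E, PosTrace ρ → Near δ ρ₀ ρ →
      qEntropy ρ ≤ qEntropy ρ₀ + ENNReal.ofReal δ →
      ∀ (ι : Type u) (g : HilbertBasis ι ℂ E) (lam : ι → ℝ), IsEigenbasis ρ g lam →
      ∀ x : ι → ℝ, (∀ i, 0 ≤ x i) → (∀ i, x i ≤ lam i) → ∑' i, x i ≤ δ →
        clEntropy x ≤ ENNReal.ofReal ε := by
  obtain ⟨δ, hδ, hl⟩ := exists_forall_sub_le_qEntropy h₀ hfin (half_pos hε)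
  set c := qEntropy ρ₀ - ENNReal.ofReal (ε / 2) with hc
  refine ⟨min (δ / 2) (ε / 2), lt_min (by linarith) (by linarith),
    fun ρ hρ hn hH ι g lam hg x hx0 hxl hxs => ?_⟩
  have hlsum := hg.hasSum hρ
  have hxsum : Summable x := hlsum.summable.of_nonneg_of_le hx0 hxl
  have hdsum : Summable fun i => lam i - x i := hlsum.summable.sub hxsum
  have hnorm : ∀ i, ‖(√(lam i - x i) : ℂ) • g i‖ ^ 2 = lam i - x i := fun i => by
    rw [norm_smul, g.orthonormal.1 i, mul_one, Complex.norm_real,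
      Real.norm_of_nonneg (Real.sqrt_nonneg _), Real.sq_sqrt (sub_nonneg.2 (hxl i))]
  obtain ⟨D, hD, -, hDg, -⟩ := exists_op_of_summable
    (φ := fun i => (√(lam i - x i) : ℂ) • g i) (by simpa only [hnorm] using hdsum)
  have h1 : c ≤ clEntropy fun i => lam i - x i := by
    refine (hl D hD fun y => ?_).trans (by simpa only [hnorm] using hDg.qEntropy_le hD)
    have hDq : HasSum (fun i => lam i * ‖⟪g i, y⟫_ℂ‖ ^ 2 - x i * ‖⟪g i, y⟫_ℂ‖ ^ 2) (qf D y) := by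
      convert hDg y using 2 with i
      rw [inner_smul_left, Complex.conj_ofReal, norm_mul, Complex.norm_real, mul_pow,
        Real.norm_of_nonneg (Real.sqrt_nonneg _), Real.sq_sqrt (sub_nonneg.2 (hxl i)), sub_mul]
    have hρq := hg.hasSum_mul_sq hρ.1.isSymmetric y
    have hdiff : HasSum (fun i => x i * ‖⟪g i, y⟫_ℂ‖ ^ 2) (qf ρ y - qf D y) := by
      simpa only [sub_sub_cancel] using hρq.sub hDq
    have hle : qf ρ y - qf D y ≤ δ / 2 * ‖y‖ ^ 2 := by
      refine hasSum_le (fun i => ?_) hdiff ((hasSum_sq_inner g y).mul_left (δ / 2))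
      have := le_of_hasSum_nonneg hx0 hxsum.hasSum i
      gcongr
      exact this.trans (hxs.trans (min_le_left _ _))
    have := abs_le.1 (hn.1 y)
    have h5 : min (δ / 2) (ε / 2) * ‖y‖ ^ 2 ≤ δ / 2 * ‖y‖ ^ 2 := by
      gcongr; exact min_le_left _ _
    linarith [this.1]
  have h2 : clEntropy x + clEntropy (fun i => lam i - x i) ≤ clEntropy lam := by
    have := clEntropy_add_le hx0 (fun i => sub_nonneg.2 (hxl i)) hxsum.hasSum hdsum.hasSum
    simpa using this
  have hcfin : c ≠ ∞ := (tsub_le_self.trans_lt hfin.lt_top).ne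
  have h3 : clEntropy x + c ≤ ENNReal.ofReal ε + c := by
    calc clEntropy x + c ≤ clEntropy lam := (add_le_add le_rfl h1).trans h2
      _ = qEntropy ρ := (hg.qEntropy_eq hρ).symm
      _ ≤ qEntropy ρ₀ + ENNReal.ofReal (ε / 2) :=
        hH.trans (add_le_add le_rfl (ENNReal.ofReal_le_ofReal (min_le_right _ _)))
      _ ≤ c + ENNReal.ofReal (ε / 2) + ENNReal.ofReal (ε / 2) :=
        add_le_add le_tsub_add le_rfl
      _ = ENNReal.ofReal ε + c := by
        rw [add_assoc, ← ENNReal.ofReal_add (by linarith) (by linarith), add_halves, add_comm]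
  exact (ENNReal.add_le_add_iff_right hcfin).1 h3

end Semicontinuity

section Upper

universe u
variable {E : Type u} {F : Type*} {ι κ : Type*}
variable [NormedAddCommGroup E] [InnerProductSpace ℂ E] [CompleteSpace E]
variable [NormedAddCommGroup F] [InnerProductSpace ℂ F] [CompleteSpace F]

open scoped InnerProductSpace

/-- The orthogonal projection onto the complement of finitely many basis vectors. -/
def basisProjCompl (e : HilbertBasis ι ℂ E) (s : Finset ι) : E →L[ℂ] E := 1 - basisProj e s

theorem adjoint_basisProjCompl (e : HilbertBasis ι ℂ E) (s : Finset ι) :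
    ContinuousLinearMap.adjoint (basisProjCompl e s) = basisProjCompl e s := by
  rw [basisProjCompl, map_sub, adjoint_basisProj, ContinuousLinearMap.one_def,
    ContinuousLinearMap.adjoint_id]

theorem norm_sq_basisProjCompl (e : HilbertBasis ι ℂ E) (s : Finset ι) (x : E) :
    ‖basisProjCompl e s x‖ ^ 2 = ‖x‖ ^ 2 - ∑ i ∈ s, ‖⟪e i, x⟫_ℂ‖ ^ 2 := by
  have h1 : ∀ i, ‖⟪e i, basisProjCompl e s x⟫_ℂ‖ ^ 2 =
      ‖⟪e i, x⟫_ℂ‖ ^ 2 - if i ∈ s then ‖⟪e i, x⟫_ℂ‖ ^ 2 else 0 := fun i => by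
    rw [basisProjCompl, sub_apply, inner_sub_right, inner_basisProj, one_apply_eq_self]
    split_ifs <;> simp
  refine (hasSum_sq_inner e _).unique ?_
  simp_rw [h1]
  exact (hasSum_sq_inner e x).sub (hasSum_ite_mem s _)

theorem basisProjCompl_basis (e : HilbertBasis ι ℂ E) (s : Finset ι) (i : ι) :
    basisProjCompl e s (e i) = if i ∈ s then 0 else e i := by
  rw [basisProjCompl, sub_apply, basisProj_basis, one_apply_eq_self]
  split_ifs <;> simp

theorem norm_basisProjCompl_le (e : HilbertBasis ι ℂ E) (s : Finset ι) (x : E) :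
    ‖basisProjCompl e s x‖ ≤ ‖x‖ := by
  refine (sq_le_sq₀ (norm_nonneg _) (norm_nonneg _)).1 ?_
  rw [norm_sq_basisProjCompl]
  have : 0 ≤ ∑ i ∈ s, ‖⟪e i, x⟫_ℂ‖ ^ 2 := Finset.sum_nonneg fun i _ => by positivity
  linarith

theorem traceENN_conj_basisProjCompl {ρ : E →L[ℂ] E} (hρ : PosTrace ρ)
    (e : HilbertBasis ι ℂ E) (s : Finset ι) :
    (traceENN (conj (basisProjCompl e s) ρ)).toReal =
      (traceENN ρ).toReal - ∑ i ∈ s, qf ρ (e i) := by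
  refine ((hρ.conj _).hasSum_qf e).unique ?_
  have h1 : ∀ i, qf (conj (basisProjCompl e s) ρ) (e i) =
      qf ρ (e i) - if i ∈ s then qf ρ (e i) else 0 := fun i => by
    rw [qf_conj, adjoint_basisProjCompl, basisProjCompl_basis]
    split_ifs <;> simp [qf]
  simp_rw [h1]
  exact (hρ.hasSum_qf e).sub (hasSum_ite_mem s _)

/-- Pinching with respect to finitely many basis vectors. -/
theorem qEntropy_le_pinching {ρ : E →L[ℂ] E} (hρ : PosTrace ρ)
    (e : HilbertBasis ι ℂ E) (s : Finset ι) {D t : ℝ} (hD : D = ∑ i ∈ s, qf ρ (e i))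
    (ht : t = (traceENN (conj (basisProjCompl e s) ρ)).toReal) :
    qEntropy ρ ≤ clEntropy (fun i => if i ∈ s then qf ρ (e i) else 0) +
      qEntropy (conj (basisProjCompl e s) ρ) +
      (ENNReal.ofReal (D * Real.log ((D + t) / D)) +
        ENNReal.ofReal (t * Real.log ((D + t) / t))) := by
  set Q := basisProjCompl e s with hQ
  have hc := hρ.conj Q
  obtain ⟨R, hR, -, hq⟩ := exists_sqrt hρ.1
  obtain ⟨κ, v, mu, hv⟩ := hc.exists_isEigenbasis
  rw [hv.qEntropy_eq hc]
  have hd0 : ∀ i, 0 ≤ if i ∈ s then qf ρ (e i) else 0 := fun i => by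
    split_ifs
    · exact qf_nonneg hρ.1 _
    · exact le_rfl
  have hsum := clEntropy_sumElim_le hd0 (hv.nonneg hc) (hD ▸ hasSum_ite_mem s fun i => qf ρ (e i))
    (ht ▸ hv.hasSum hc)
  refine le_trans ?_ hsum
  have hgen : Generates (Sum.elim (fun i => if i ∈ s then R (e i) else 0)
      (fun k => R (Q (v k)))) ρ := fun x => by
    have h1 : HasSum (fun i => ‖⟪if i ∈ s then R (e i) else 0, x⟫_ℂ‖ ^ 2)
        (∑ i ∈ s, ‖⟪e i, R x⟫_ℂ‖ ^ 2) := by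
      convert hasSum_ite_mem s fun i => ‖⟪e i, R x⟫_ℂ‖ ^ 2 using 2 with i
      split_ifs
      · rw [inner_adjoint_eq_self hR]
      · simp
    have h2 : HasSum (fun k => ‖⟪R (Q (v k)), x⟫_ℂ‖ ^ 2)
        (‖R x‖ ^ 2 - ∑ i ∈ s, ‖⟪e i, R x⟫_ℂ‖ ^ 2) := by
      rw [← norm_sq_basisProjCompl, ← hQ]
      convert hasSum_sq_inner v (Q (R x)) using 3 with k
      rw [inner_adjoint_eq_self hR, inner_adjoint_eq_self (adjoint_basisProjCompl e s)]
    have h3 := HasSum.sum (f := fun k => ‖⟪Sum.elim (fun i => if i ∈ s then R (e i) else 0)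
      (fun k => R (Q (v k))) k, x⟫_ℂ‖ ^ 2) h1 h2
    rwa [add_sub_cancel, ← hq] at h3
  refine (hgen.qEntropy_le hρ).trans (le_of_eq ?_)
  congr 1
  funext k
  rcases k with i | k
  · simp only [Sum.elim_inl, hq]
    split_ifs <;> simp
  · rw [Sum.elim_inr, Sum.elim_inr, ← hq, ← hv.qf_apply, qf_conj, adjoint_basisProjCompl]

/-- Upper estimate of the entropy near an operator of finite entropy, up to the entropy of a
compression of small trace. -/
theorem exists_forall_qEntropy_le {ρ₀ : E →L[ℂ] E} (h₀ : PosTrace ρ₀) (hfin : qEntropy ρ₀ ≠ ∞)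
    {ε τ : ℝ} (hε : 0 < ε) (hτ : 0 < τ) :
    ∃ Q : E →L[ℂ] E, (∀ x, ‖Q x‖ ≤ ‖x‖) ∧ ∃ δ : ℝ, 0 < δ ∧
      ∀ ρ : E →L[ℂ] E, PosTrace ρ → Near δ ρ₀ ρ → (traceENN (conj Q ρ)).toReal ≤ τ ∧
        qEntropy ρ ≤ qEntropy ρ₀ + ENNReal.ofReal ε + qEntropy (conj Q ρ) := by
  obtain ⟨ι, e, lam, he⟩ := h₀.exists_isEigenbasis
  have hl0 := he.nonneg h₀
  have hls := he.hasSum h₀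
  set T := (traceENN ρ₀).toReal with hT
  have hT0 : 0 ≤ T := ENNReal.toReal_nonneg
  set h := (qEntropy ρ₀).toReal with hh
  have hh0 : 0 ≤ h := ENNReal.toReal_nonneg
  set a : ℝ := 1 + 4 * (T + 1) / ε with ha
  have ha1 : 1 ≤ a := by
    have : 0 ≤ 4 * (T + 1) / ε := by positivity
    linarith
  have ha0 : 0 < a := by linarith
  have hCa : (T + 1) / a ≤ ε / 4 := by
    rw [div_le_iff₀ ha0, ha]
    have : ε / 4 * (1 + 4 * (T + 1) / ε) = ε / 4 + (T + 1) := by field_simp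
    linarith
  have hloga := Real.log_nonneg ha1
  set τ' := min τ (ε / (4 * (1 + Real.log a))) with hτ'
  have hτ'0 : 0 < τ' := lt_min hτ (by positivity)
  have hτ'a : τ' * (1 + Real.log a) ≤ ε / 4 := by
    calc τ' * (1 + Real.log a) ≤ ε / (4 * (1 + Real.log a)) * (1 + Real.log a) := by
          gcongr; exact min_le_right _ _
      _ = ε / 4 := by field_simp
  set δ₁ := ε / (2 * (h + 1)) with hδ₁
  have hδ₁0 : 0 < δ₁ := by positivity
  have hδ₁h : δ₁ * h ≤ ε / 2 := by
    rw [hδ₁, div_mul_eq_mul_div, div_le_div_iff₀ (by positivity) (by positivity)]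
    nlinarith
  obtain ⟨s, hs, hsT⟩ : ∃ s : Finset ι, (∀ i ∈ s, 0 < lam i) ∧ T - τ' / 2 ≤ ∑ i ∈ s, lam i := by
    obtain ⟨s, hs⟩ := (hls.eventually_const_le (show T - τ' / 2 < T by linarith)).exists
    refine ⟨s.filter fun i => 0 < lam i, fun i hi => (Finset.mem_filter.1 hi).2, hs.trans ?_⟩
    rw [Finset.sum_filter]
    refine Finset.sum_le_sum fun i _ => ?_
    split_ifs with hi
    · exact le_rfl
    · exact not_lt.1 hi
  obtain ⟨δ₂, hδ₂, hδ₂s⟩ := exists_pos_forall_le s (fun i => δ₁ * lam i)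
    fun i hi => mul_pos hδ₁0 (hs i hi)
  set N : ℝ := 1 + s.card with hN
  have hN0 : 0 < N := by positivity
  refine ⟨basisProjCompl e s, norm_basisProjCompl_le e s, min (min 1 δ₂) (τ' / (2 * N)),
    lt_min (lt_min one_pos hδ₂) (by positivity), fun ρ hρ hn => ?_⟩
  set δ := min (min 1 δ₂) (τ' / (2 * N)) with hδ
  have hδ1 : δ ≤ 1 := (min_le_left _ _).trans (min_le_left _ _)
  have hδδ₂ : δ ≤ δ₂ := (min_le_left _ _).trans (min_le_right _ _)
  have hδN : δ * N ≤ τ' / 2 := by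
    calc δ * N ≤ τ' / (2 * N) * N := by gcongr; exact min_le_right _ _
      _ = τ' / 2 := by field_simp
  have hqe : ∀ i, |qf ρ (e i) - lam i| ≤ δ := fun i => by
    have := hn.1 (e i)
    rwa [he.qf_apply, e.orthonormal.1 i, one_pow, mul_one] at this
  set D := ∑ i ∈ s, qf ρ (e i) with hD
  set t := (traceENN (conj (basisProjCompl e s) ρ)).toReal with ht
  have hD0 : 0 ≤ D := Finset.sum_nonneg fun i _ => qf_nonneg hρ.1 _
  have ht0 : 0 ≤ t := ENNReal.toReal_nonneg
  have htD : t = (traceENN ρ).toReal - D := traceENN_conj_basisProjCompl hρ e s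
  have hDl : ∑ i ∈ s, lam i - δ * s.card ≤ D := by
    have : ∑ i ∈ s, (lam i - δ) ≤ D :=
      Finset.sum_le_sum fun i _ => by linarith [(abs_le.1 (hqe i)).1]
    rw [Finset.sum_sub_distrib, Finset.sum_const, nsmul_eq_mul] at this
    linarith
  have htτ : t ≤ τ' := by
    have h1 := hn.2
    have h2 : δ * N = δ + δ * s.card := by rw [hN]; ring
    linarith
  refine ⟨htτ.trans (min_le_left _ _), (qEntropy_le_pinching hρ e s hD ht).trans ?_⟩
  have hd : clEntropy (fun i => if i ∈ s then qf ρ (e i) else 0) ≤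
      qEntropy ρ₀ + ENNReal.ofReal (ε / 2) := by
    refine (clEntropy_mono (y := fun i => (1 + δ₁) * lam i) (fun i => ?_) (fun i => ?_)
      (hls.summable.mul_left _)).trans ?_
    · split_ifs
      · exact qf_nonneg hρ.1 _
      · exact le_rfl
    · split_ifs with hi
      · linarith [(abs_le.1 (hqe i)).2, hδ₂s i hi]
      · exact mul_nonneg (by positivity) (hl0 i)
    · rw [clEntropy_const_mul (by positivity) hl0 hls.summable, ← he.qEntropy_eq h₀,
        ENNReal.ofReal_add zero_le_one hδ₁0.le, ENNReal.ofReal_one, add_mul, one_mul]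
      gcongr
      rw [← ENNReal.ofReal_toReal hfin, ← ENNReal.ofReal_mul hδ₁0.le]
      exact ENNReal.ofReal_le_ofReal hδ₁h
  have hl1 : D * Real.log ((D + t) / D) ≤ t := by
    have := mul_log_div_le hD0 (le_add_of_nonneg_right ht0) one_pos
    simpa using this
  have hl2 : t * Real.log ((D + t) / t) ≤ t * Real.log a + ε / 4 := by
    have h1 := mul_log_div_le ht0 (le_add_of_nonneg_left hD0) ha0
    have h2 : (D + t) / a ≤ (T + 1) / a := by
      refine div_le_div_of_nonneg_right ?_ ha0.le
      linarith [hn.2]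
    linarith
  have hl3 : t + t * Real.log a ≤ ε / 4 := by
    calc t + t * Real.log a = t * (1 + Real.log a) := by ring
      _ ≤ τ' * (1 + Real.log a) := by gcongr
      _ ≤ ε / 4 := hτ'a
  have hl4 : ENNReal.ofReal (D * Real.log ((D + t) / D)) +
      ENNReal.ofReal (t * Real.log ((D + t) / t)) ≤ ENNReal.ofReal (ε / 2) := by
    rw [← ENNReal.ofReal_add (mul_log_div_nonneg hD0 (le_add_of_nonneg_right ht0))
      (mul_log_div_nonneg ht0 (le_add_of_nonneg_left hD0))]
    exact ENNReal.ofReal_le_ofReal (by linarith)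
  refine (add_le_add (add_le_add hd le_rfl) hl4).trans (le_of_eq ?_)
  rw [← add_halves ε, ENNReal.ofReal_add (half_pos hε).le (half_pos hε).le, add_halves]
  ring

end Upper

section Stability

universe u
variable {E : Type u} {F : Type*} {ι κ : Type*}
variable [NormedAddCommGroup E] [InnerProductSpace ℂ E] [CompleteSpace E]
variable [NormedAddCommGroup F] [InnerProductSpace ℂ F] [CompleteSpace F]

open scoped InnerProductSpace

theorem qf_add (A B : E →L[ℂ] E) (x : E) : qf (A + B) x = qf A x + qf B x := by
  simp [qf]

theorem PosTrace.qf_le {A : E →L[ℂ] E} (hA : PosTrace A) (x : E) :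
    qf A x ≤ (traceENN A).toReal * ‖x‖ ^ 2 := by
  obtain ⟨κ, φ, hφ, -⟩ := hA.exists_generates
  refine hasSum_le (fun k => ?_) (hφ x) ((hφ.hasSum_norm_sq hA).mul_right _)
  rw [← mul_pow]
  exact pow_le_pow_left₀ (norm_nonneg _) (norm_inner_le_norm _ _) 2

theorem TraceMap.posTrace (Ψ : TraceMap E F) {A : E →L[ℂ] E} (hA : PosTrace A) :
    PosTrace (Ψ.toFun A) :=
  .of_mem_posTC ⟨Ψ.pos A hA.isTC hA.1, Ψ.maps_tc A hA.isTC⟩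

theorem IsEigenbasis.tsum_abs_le {X : E →L[ℂ] E} {e : HilbertBasis ι ℂ E} {x : ι → ℝ}
    (h : IsEigenbasis X e x) : ∑' i, ENNReal.ofReal |x i| ≤ traceNorm X := by
  rw [ENNReal.tsum_eq_iSup_sum]
  refine iSup_le fun s => ?_
  have hs : Orthonormal ℂ fun i : Fin s.card => e (s.equivFin.symm i) :=
    e.orthonormal.comp _ (Subtype.val_injective.comp s.equivFin.symm.injective)
  refine le_trans (le_of_eq ?_) (le_iSup_of_le s.card (le_iSup_of_le _ (le_iSup_of_le _
    (le_iSup_of_le hs (le_iSup_of_le hs le_rfl)))))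
  have hx : ∀ i, ‖⟪e i, X (e i)⟫_ℂ‖ = |x i| := fun i => by
    rw [h, inner_smul_right, inner_self_eq_norm_sq_to_K, e.orthonormal.1 i]
    simp
  simp_rw [hx]
  rw [← s.sum_coe_sort fun i => ENNReal.ofReal |x i|]
  exact (s.equivFin.symm.sum_comp fun i : s => ENNReal.ofReal |x i|).symm

/-- The operator diagonal in the basis `e` with nonnegative summable eigenvalues `x`. -/
theorem exists_diagonal (e : HilbertBasis ι ℂ E) {x : ι → ℝ} {T : ℝ} (hx : ∀ i, 0 ≤ x i)
    (hs : HasSum x T) : ∃ A : E →L[ℂ] E, PosTrace A ∧ (traceENN A).toReal = T ∧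
      ∀ u v, HasSum (fun i => (x i : ℂ) * (⟪u, e i⟫_ℂ * ⟪e i, v⟫_ℂ)) ⟪u, A v⟫_ℂ := by
  have hnorm : ∀ i, ‖(√(x i) : ℂ) • e i‖ ^ 2 = x i := fun i => by
    rw [norm_smul, e.orthonormal.1 i, mul_one, Complex.norm_real,
      Real.norm_of_nonneg (Real.sqrt_nonneg _), Real.sq_sqrt (hx i)]
  obtain ⟨A, hA, -, hg, hi⟩ := exists_op_of_summable
    (φ := fun i => (√(x i) : ℂ) • e i) (by simpa only [hnorm] using hs.summable)
  refine ⟨A, hA, ?_, fun u v => ?_⟩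
  · exact (hg.hasSum_norm_sq hA).unique (by simpa only [hnorm] using hs)
  · convert hi u v using 2 with i
    rw [inner_smul_left, inner_smul_right, Complex.conj_ofReal, mul_mul_mul_comm,
      ← Complex.ofReal_mul, Real.mul_self_sqrt (hx i)]

/-- The Jordan decomposition of the difference of two positive trace-class operators. -/
theorem exists_jordan {A B : E →L[ℂ] E} (hA : PosTrace A) (hB : PosTrace B) {δ : ℝ}
    (h : traceNorm (B - A) < ENNReal.ofReal δ) :
    ∃ X Y : E →L[ℂ] E, PosTrace X ∧ PosTrace Y ∧ (traceENN X).toReal ≤ δ ∧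
      (traceENN Y).toReal ≤ δ ∧ B + Y = A + X := by
  have hδ : 0 ≤ δ := by
    by_contra! hn
    simp [ENNReal.ofReal_of_nonpos hn.le] at h
  have hc : IsCompactOperator (B - A) := hB.isCompactOperator.sub hA.isCompactOperator
  have hsym : ((B - A : E →L[ℂ] E) : E →ₗ[ℂ] E).IsSymmetric :=
    hB.1.isSymmetric.sub hA.1.isSymmetric
  obtain ⟨ι, e, x, he⟩ := exists_isEigenbasis_of_isCompactOperator hc hsym
  have hlt := (he.tsum_abs_le.trans_lt h)
  have hs : Summable fun i => |x i| := by
    have := ENNReal.summable_toReal (hlt.trans ENNReal.ofReal_lt_top).ne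
    simpa using this
  have hle : ∑' i, |x i| ≤ δ := by
    rw [← ENNReal.ofReal_le_ofReal_iff hδ, ← tsum_ofReal_of_hasSum (fun i => abs_nonneg _) hs.hasSum]
    exact hlt.le
  have hp : Summable fun i => max (x i) 0 := hs.of_nonneg_of_le (fun i => le_max_right _ _)
    fun i => max_le (le_abs_self _) (abs_nonneg _)
  have hm : Summable fun i => max (-x i) 0 := hs.of_nonneg_of_le (fun i => le_max_right _ _)
    fun i => max_le (neg_le_abs _) (abs_nonneg _)
  obtain ⟨X, hX, hXt, hXi⟩ := exists_diagonal e (fun i => le_max_right _ _) hp.hasSum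
  obtain ⟨Y, hY, hYt, hYi⟩ := exists_diagonal e (fun i => le_max_right _ _) hm.hasSum
  refine ⟨X, Y, hX, hY, ?_, ?_, ?_⟩
  · rw [hXt]
    exact (hp.tsum_le_tsum (fun i => max_le (le_abs_self _) (abs_nonneg _)) hs).trans hle
  · rw [hYt]
    exact (hm.tsum_le_tsum (fun i => max_le (neg_le_abs _) (abs_nonneg _)) hs).trans hle
  · have hsub : B - A = X - Y := by
      refine ContinuousLinearMap.ext fun v => ext_inner_left ℂ fun u => ?_
      have h1 := (hXi u v).sub (hYi u v)
      rw [← inner_sub_right, ← sub_apply] at h1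
      have h2 := e.hasSum_inner_mul_inner u ((B - A) v)
      refine h2.unique ?_
      refine h1.congr_fun fun i => ?_
      have h3 := hsym (e i) v
      simp only [ContinuousLinearMap.coe_coe] at h3
      rw [← h3, he, inner_smul_left, Complex.conj_ofReal, ← sub_mul, ← Complex.ofReal_sub]
      have h4 : max (x i) 0 - max (-x i) 0 = x i := by
        rcases le_total 0 (x i) with h | h
        · rw [max_eq_left h, max_eq_right (by linarith), sub_zero]
        · rw [max_eq_right h, max_eq_left (by linarith)]; ring
      rw [h4]
      ring
    rw [sub_eq_sub_iff_add_eq_add] at hsub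
    rw [hsub, add_comm]

theorem near_of_traceNorm_lt (Ψ : TraceMap E F) (hΨ : Ψ.TNI) {A B : E →L[ℂ] E}
    (hA : PosTrace A) (hB : PosTrace B) {δ : ℝ} (h : traceNorm (B - A) < ENNReal.ofReal δ) :
    Near δ (Ψ.toFun A) (Ψ.toFun B) := by
  obtain ⟨X, Y, hX, hY, hXt, hYt, hXY⟩ := exists_jordan hA hB h
  have hadd : Ψ.toFun B + Ψ.toFun Y = Ψ.toFun A + Ψ.toFun X := by
    rw [← Ψ.map_add B Y hB.isTC hY.isTC, hXY, Ψ.map_add A X hA.isTC hX.isTC]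
  have hqf : ∀ y, qf (Ψ.toFun B) y + qf (Ψ.toFun Y) y = qf (Ψ.toFun A) y + qf (Ψ.toFun X) y :=
    fun y => by rw [← qf_add, hadd, qf_add]
  have htr : ∀ Z : E →L[ℂ] E, PosTrace Z → (traceENN Z).toReal ≤ δ →
      (traceENN (Ψ.toFun Z)).toReal ≤ δ := fun Z hZ hZt =>
    (ENNReal.toReal_mono hZ.2 (hΨ Z hZ.isTC hZ.1)).trans hZt
  have hq : ∀ Z : E →L[ℂ] E, PosTrace Z → (traceENN Z).toReal ≤ δ →
      ∀ y, qf (Ψ.toFun Z) y ≤ δ * ‖y‖ ^ 2 := fun Z hZ hZt y =>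
    ((Ψ.posTrace hZ).qf_le y).trans (by gcongr; exact htr Z hZ hZt)
  refine ⟨fun y => abs_le.2 ⟨?_, ?_⟩, ?_⟩
  · linarith [hqf y, hq Y hY hYt y, qf_nonneg (Ψ.posTrace hX).1 y]
  · linarith [hqf y, hq X hX hXt y, qf_nonneg (Ψ.posTrace hY).1 y]
  · obtain ⟨w, b, -⟩ := exists_hilbertBasis ℂ F
    have h1 := ((Ψ.posTrace hB).hasSum_qf b).add ((Ψ.posTrace hY).hasSum_qf b)
    simp_rw [hqf] at h1
    have h2 := h1.unique (((Ψ.posTrace hA).hasSum_qf b).add ((Ψ.posTrace hX).hasSum_qf b))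
    have h3 : 0 ≤ (traceENN (Ψ.toFun Y)).toReal := ENNReal.toReal_nonneg
    linarith [htr X hX hXt]

/-- The identity map. -/
def TraceMap.id (E : Type*) [NormedAddCommGroup E] [InnerProductSpace ℂ E] [CompleteSpace E] :
    TraceMap E E where
  toFun A := A
  map_add _ _ _ _ := rfl
  map_smul _ _ _ := rfl
  maps_tc _ h := h
  pos _ _ h := h

theorem TraceMap.tni_id : (TraceMap.id E).TNI := fun _ _ _ => le_rfl

end Stability

section Domination

universe u₁ u₂ u₃
variable {E : Type*} {F₁ : Type u₁} {F₂ : Type u₂} {F₃ : Type u₃}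
variable [NormedAddCommGroup E] [InnerProductSpace ℂ E] [CompleteSpace E]
variable [NormedAddCommGroup F₁] [InnerProductSpace ℂ F₁] [CompleteSpace F₁]
variable [NormedAddCommGroup F₂] [InnerProductSpace ℂ F₂] [CompleteSpace F₂]
variable [NormedAddCommGroup F₃] [InnerProductSpace ℂ F₃] [CompleteSpace F₃]

open scoped InnerProductSpace

/-- The entropy of every contraction of `Z` is dominated by the entropies of parts of the
spectra of `X` and `Y`, up to a multiple of the trace. -/
def Dominated (X : F₁ →L[ℂ] F₁) (Y : F₂ →L[ℂ] F₂) (Z : F₃ →L[ℂ] F₃) (C : ℝ) : Prop :=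
  ∀ Q : F₃ →L[ℂ] F₃, (∀ x, ‖Q x‖ ≤ ‖x‖) →
    ∃ (ι : Type u₁) (κ : Type u₂) (f : HilbertBasis ι ℂ F₁) (g : HilbertBasis κ ℂ F₂)
      (lam : ι → ℝ) (mu : κ → ℝ) (x : ι → ℝ) (y : κ → ℝ),
      IsEigenbasis X f lam ∧ IsEigenbasis Y g mu ∧
      ((∀ i, 0 ≤ x i) ∧ (∀ i, x i ≤ lam i) ∧ ∑' i, x i ≤ (traceENN (conj Q Z)).toReal) ∧
      ((∀ k, 0 ≤ y k) ∧ (∀ k, y k ≤ mu k) ∧ ∑' k, y k ≤ (traceENN (conj Q Z)).toReal) ∧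
      qEntropy (conj Q Z) ≤ clEntropy x + clEntropy y +
        ENNReal.ofReal (C * (traceENN (conj Q Z)).toReal)

theorem Dominated.qEntropy_ne_top {X : F₁ →L[ℂ] F₁} {Y : F₂ →L[ℂ] F₂} {Z : F₃ →L[ℂ] F₃} {C : ℝ}
    (h : Dominated X Y Z C) (hX : PosTrace X) (hY : PosTrace Y) (hXf : qEntropy X ≠ ∞)
    (hYf : qEntropy Y ≠ ∞) : qEntropy Z ≠ ∞ := by
  obtain ⟨ι, κ, f, g, lam, mu, x, y, hf, hg, hx, hy, hH⟩ := h 1 fun x => le_rfl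
  have h1 : conj 1 Z = Z := by
    rw [conj, ContinuousLinearMap.one_def, ContinuousLinearMap.adjoint_id,
      ContinuousLinearMap.comp_id, ContinuousLinearMap.id_comp]
  rw [h1] at hH
  refine ne_top_of_le_ne_top ?_ hH
  rw [hf.qEntropy_eq hX] at hXf
  rw [hg.qEntropy_eq hY] at hYf
  exact ENNReal.add_ne_top.2 ⟨ENNReal.add_ne_top.2
    ⟨ne_top_of_le_ne_top hXf (clEntropy_mono hx.1 hx.2.1 (hf.hasSum hX).summable),
      ne_top_of_le_ne_top hYf (clEntropy_mono hy.1 hy.2.1 (hg.hasSum hY).summable)⟩,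
    ENNReal.ofReal_ne_top⟩

theorem ContOn.exists_forall_le {f : (E →L[ℂ] E) → ℝ≥0∞} {𝒜 : Set (E →L[ℂ] E)}
    (h : ContOn f 𝒜) {A : E →L[ℂ] E} (hA : A ∈ 𝒜) {ε : ℝ} (hε : 0 < ε) :
    ∃ δ : ℝ, 0 < δ ∧ ∀ B ∈ 𝒜, traceNorm (B - A) < ENNReal.ofReal δ →
      f B ≤ f A + ENNReal.ofReal ε := by
  obtain ⟨δ, hδ, hB⟩ := h.2 A hA ε hε
  refine ⟨δ, hδ, fun B hB' hn => ?_⟩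
  have h1 := (abs_lt.1 (hB B hB' hn)).2
  rw [← ENNReal.ofReal_toReal (h.1 A hA), ← ENNReal.ofReal_toReal (h.1 B hB'),
    ← ENNReal.ofReal_add ENNReal.toReal_nonneg hε.le]
  exact ENNReal.ofReal_le_ofReal (by linarith)

/-- Continuity of the entropy is transferred along a domination. -/
theorem contOn_outEntropy_of_dominated {X : TraceMap E F₁} {Y : TraceMap E F₂}
    {Z : TraceMap E F₃} (hX : X.TNI) (hY : Y.TNI) (hZ : Z.TNI) {C : ℝ} (hC : 0 ≤ C)
    (hdom : ∀ A, PosTrace A → Dominated (X.toFun A) (Y.toFun A) (Z.toFun A) C)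
    {𝒜 : Set (E →L[ℂ] E)} (h𝒜 : 𝒜 ⊆ posTC E) (hcX : ContOn (outEntropy X) 𝒜)
    (hcY : ContOn (outEntropy Y) 𝒜) : ContOn (outEntropy Z) 𝒜 := by
  have hpt : ∀ A ∈ 𝒜, PosTrace A := fun A hA => .of_mem_posTC (h𝒜 hA)
  have hfin : ∀ A ∈ 𝒜, outEntropy Z A ≠ ∞ := fun A hA =>
    (hdom A (hpt A hA)).qEntropy_ne_top (X.posTrace (hpt A hA)) (Y.posTrace (hpt A hA))
      (hcX.1 A hA) (hcY.1 A hA)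
  refine ⟨hfin, fun A hA ε hε => ?_⟩
  have hε8 : 0 < ε / 8 := by linarith
  have hA' := hpt A hA
  obtain ⟨δl, hδl, hl⟩ := exists_forall_sub_le_qEntropy (Z.posTrace hA') (hfin A hA)
    (half_pos hε)
  obtain ⟨δx, hδx, hx⟩ := exists_forall_clEntropy_le (X.posTrace hA') (hcX.1 A hA) hε8
  obtain ⟨δy, hδy, hy⟩ := exists_forall_clEntropy_le (Y.posTrace hA') (hcY.1 A hA) hε8
  obtain ⟨ηx, hηx, hxB⟩ := hcX.exists_forall_le hA hδx
  obtain ⟨ηy, hηy, hyB⟩ := hcY.exists_forall_le hA hδy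
  set τ := min (min δx δy) (ε / (8 * (C + 1))) with hτ
  have hτ0 : 0 < τ := lt_min (lt_min hδx hδy) (by positivity)
  have hτC : C * τ ≤ ε / 8 := by
    calc C * τ ≤ (C + 1) * (ε / (8 * (C + 1))) :=
          mul_le_mul (by linarith) (min_le_right _ _) hτ0.le (by positivity)
      _ = ε / 8 := by field_simp
  obtain ⟨Q, hQ, δz, hδz, hz⟩ := exists_forall_qEntropy_le (Z.posTrace hA') (hfin A hA) hε8 hτ0
  obtain ⟨δ, hδ0, hδ⟩ : ∃ δ : ℝ, 0 < δ ∧ δ ≤ δl ∧ δ ≤ δx ∧ δ ≤ δy ∧ δ ≤ ηx ∧ δ ≤ ηy ∧ δ ≤ δz :=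
    ⟨min δl (min δx (min δy (min ηx (min ηy δz)))), by simp [*], by simp⟩
  obtain ⟨hdl, hdx, hdy, hex, hey, hdz⟩ := hδ
  refine ⟨δ, hδ0, fun B hB hn => ?_⟩
  have hB' := hpt B hB
  have hnX := near_of_traceNorm_lt X hX hA' hB' hn
  have hnY := near_of_traceNorm_lt Y hY hA' hB' hn
  have hnZ := near_of_traceNorm_lt Z hZ hA' hB' hn
  have hlow : outEntropy Z A ≤ outEntropy Z B + ENNReal.ofReal (ε / 2) := by
    refine tsub_le_iff_right.1 (hl _ (Z.posTrace hB') fun v => ?_)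
    linarith [(abs_le.1 ((hnZ.mono hdl).1 v)).1]
  have hup : outEntropy Z B ≤ outEntropy Z A + ENNReal.ofReal (ε / 2) := by
    obtain ⟨ht, hH⟩ := hz _ (Z.posTrace hB') (hnZ.mono hdz)
    obtain ⟨ι, κ, f, g, lam, mu, x, y, hf, hg, hxx, hyy, hD⟩ := hdom B hB' Q hQ
    have h1 : clEntropy x ≤ ENNReal.ofReal (ε / 8) := by
      refine hx _ (X.posTrace hB') (hnX.mono hdx) ?_ ι f lam hf x hxx.1 hxx.2.1 ?_
      · exact hxB B hB (hn.trans_le (ENNReal.ofReal_le_ofReal hex))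
      · exact hxx.2.2.trans (ht.trans ((min_le_left _ _).trans (min_le_left _ _)))
    have h2 : clEntropy y ≤ ENNReal.ofReal (ε / 8) := by
      refine hy _ (Y.posTrace hB') (hnY.mono hdy) ?_ κ g mu hg y hyy.1 hyy.2.1 ?_
      · exact hyB B hB (hn.trans_le (ENNReal.ofReal_le_ofReal hey))
      · exact hyy.2.2.trans (ht.trans ((min_le_left _ _).trans (min_le_right _ _)))
    have h3 : ENNReal.ofReal (C * (traceENN (conj Q (Z.toFun B))).toReal) ≤
        ENNReal.ofReal (ε / 8) :=
      ENNReal.ofReal_le_ofReal ((mul_le_mul_of_nonneg_left ht hC).trans hτC)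
    calc outEntropy Z B ≤ outEntropy Z A + ENNReal.ofReal (ε / 8) +
          (ENNReal.ofReal (ε / 8) + ENNReal.ofReal (ε / 8) + ENNReal.ofReal (ε / 8)) :=
          hH.trans (add_le_add le_rfl (hD.trans (add_le_add (add_le_add h1 h2) h3)))
      _ = outEntropy Z A + ENNReal.ofReal (ε / 2) := by
          rw [add_assoc, ← ENNReal.ofReal_add hε8.le hε8.le,
            ← ENNReal.ofReal_add (by linarith) hε8.le, ← ENNReal.ofReal_add hε8.le (by linarith)]
          congr 2
          ring
  have hAf := hfin A hA
  have hBf := hfin B hB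
  have htr : ∀ p q : ℝ≥0∞, p ≠ ∞ → q ≠ ∞ → p ≤ q + ENNReal.ofReal (ε / 2) →
      p.toReal ≤ q.toReal + ε / 2 := fun p q _ hq hpq => by
    have := ENNReal.toReal_mono (ENNReal.add_ne_top.2 ⟨hq, ENNReal.ofReal_ne_top⟩) hpq
    rwa [ENNReal.toReal_add hq ENNReal.ofReal_ne_top,
      ENNReal.toReal_ofReal (half_pos hε).le] at this
  rw [abs_lt]
  constructor
  · linarith [htr _ _ hAf hBf hlow]
  · linarith [htr _ _ hBf hAf hup]

end Domination

section Dilation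

variable {E F G ι κ : Type*}
variable [NormedAddCommGroup E] [InnerProductSpace ℂ E] [CompleteSpace E]
variable [NormedAddCommGroup F] [InnerProductSpace ℂ F] [CompleteSpace F]
variable [NormedAddCommGroup G] [InnerProductSpace ℂ G] [CompleteSpace G]

open scoped InnerProductSpace

theorem qf_one_sub (S : E →L[ℂ] E) (x : E) : qf (1 - S) x = ‖x‖ ^ 2 - qf S x := by
  simp only [qf, sub_apply, one_apply_eq_self, inner_sub_right, Complex.sub_re]
  rw [← inner_self_eq_norm_sq (𝕜 := ℂ)]
  rfl

theorem hasSum_sq_norm_kraus {V : ℕ → E →L[ℂ] F} {S : E →L[ℂ] E}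
    (hS : ∀ x : E, HasSum (fun i => (ContinuousLinearMap.adjoint (V i)) (V i x)) (S x)) (x : E) :
    HasSum (fun i => ‖V i x‖ ^ 2) (qf S x) := by
  have h := (hS x).mapL (Complex.reCLM.comp ((innerSL ℂ x).restrictScalars ℝ))
  refine h.congr_fun fun i => ?_
  have h1 : (⟪x, ContinuousLinearMap.adjoint (V i) (V i x)⟫_ℂ).re = ‖V i x‖ ^ 2 := by
    rw [ContinuousLinearMap.adjoint_inner_right]
    exact inner_self_eq_norm_sq (𝕜 := ℂ) _
  exact h1.symm

theorem qf_le_of_krausTNI {V : ℕ → E →L[ℂ] F} {S : E →L[ℂ] E} (hV : KrausTNI V)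
    (hS : ∀ x : E, HasSum (fun i => (ContinuousLinearMap.adjoint (V i)) (V i x)) (S x)) (x : E) :
    qf S x ≤ ‖x‖ ^ 2 := by
  refine le_of_tendsto (hasSum_sq_norm_kraus hS x).tendsto_sum_nat (Eventually.of_forall fun n => ?_)
  have h := qf_nonneg (hV n) x
  rw [qf_one_sub] at h
  have h1 : qf (∑ i ∈ Finset.range n, ContinuousLinearMap.adjoint (V i) ∘L V i) x =
      ∑ i ∈ Finset.range n, ‖V i x‖ ^ 2 := by
    simp only [qf, sum_apply, inner_sum, Complex.re_sum]
    refine Finset.sum_congr rfl fun i _ => ?_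
    rw [ContinuousLinearMap.comp_apply, ContinuousLinearMap.adjoint_inner_right]
    exact inner_self_eq_norm_sq (𝕜 := ℂ) _
  linarith

/-- The two families of partial contractions of the Stinespring operator `x ↦ ∑ᵢ Vᵢ x ⊗ bᵢ`,
with a vector of the second and of the first tensor factor respectively. -/
theorem exists_contractions {V : ℕ → E →L[ℂ] F} (b : HilbertBasis ℕ ℂ G)
    {q : E → ℝ} (hq : ∀ x, HasSum (fun i => ‖V i x‖ ^ 2) (q x)) (hle : ∀ x, q x ≤ ‖x‖ ^ 2) :
    ∃ (K : G → E →L[ℂ] F) (L : F → E →L[ℂ] G),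
      (∀ f g x, ⟪f, K g x⟫_ℂ = ⟪g, L f x⟫_ℂ) ∧ ∀ i, K (b i) = V i := by
  have hsum : ∀ f x, Summable fun i => ‖⟪f, V i x⟫_ℂ‖ ^ 2 := fun f x => by
    refine Summable.of_nonneg_of_le (fun i => by positivity) (fun i => ?_)
      ((hq x).summable.mul_left (‖f‖ ^ 2))
    rw [← mul_pow]
    gcongr
    exact norm_inner_le_norm _ _
  have hmem : ∀ f x, Memℓp (fun i => ⟪f, V i x⟫_ℂ) 2 := fun f x => by
    refine memℓp_gen ?_
    simpa using hsum f x
  let L₀ : F → E → G := fun f x => b.repr.symm ⟨fun i => ⟪f, V i x⟫_ℂ, hmem f x⟩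
  have hL₀ : ∀ f x i, ⟪b i, L₀ f x⟫_ℂ = ⟪f, V i x⟫_ℂ := fun f x i => by
    rw [← HilbertBasis.repr_apply_apply]
    simp [L₀]
  have hext : ∀ y z : G, (∀ i, ⟪b i, y⟫_ℂ = ⟪b i, z⟫_ℂ) → y = z := fun y z h => by
    refine b.repr.injective ?_
    ext i
    rw [HilbertBasis.repr_apply_apply, HilbertBasis.repr_apply_apply, h]
  have hbound : ∀ f x, ‖L₀ f x‖ ≤ ‖f‖ * ‖x‖ := fun f x => by
    refine (sq_le_sq₀ (norm_nonneg _) (by positivity)).1 ?_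
    rw [mul_pow]
    refine (hasSum_le (fun i => ?_) (hasSum_sq_inner b _) ((hq x).mul_left (‖f‖ ^ 2))).trans ?_
    · rw [hL₀, ← mul_pow]
      gcongr
      exact norm_inner_le_norm _ _
    · gcongr
      exact hle x
  obtain ⟨L, hL, hLb⟩ : ∃ L : F → E →L[ℂ] G, (∀ f x i, ⟪b i, L f x⟫_ℂ = ⟪f, V i x⟫_ℂ) ∧
      ∀ f, ‖L f‖ ≤ ‖f‖ :=
    ⟨fun f => LinearMap.mkContinuous
      { toFun := L₀ f
        map_add' := fun x y => hext _ _ fun i => by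
          rw [inner_add_right, hL₀, hL₀, hL₀, map_add, inner_add_right]
        map_smul' := fun c x => hext _ _ fun i => by
          rw [RingHom.id_apply, inner_smul_right, hL₀, hL₀, map_smul, inner_smul_right] }
      ‖f‖ (hbound f), hL₀, fun f => LinearMap.mkContinuous_norm_le _ (norm_nonneg _) _⟩
  have hLadd : ∀ f f', L (f + f') = L f + L f' := fun f f' => by
    ext x
    refine hext _ _ fun i => ?_
    rw [add_apply, inner_add_right, hL, hL, hL, inner_add_left]
  have hLsmul : ∀ (c : ℂ) f, L (c • f) = (starRingEnd ℂ c) • L f := fun c f => by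
    ext x
    refine hext _ _ fun i => ?_
    rw [smul_apply, inner_smul_right, hL, hL, inner_smul_left]
  have hTb : ∀ f g, ‖ContinuousLinearMap.adjoint (L f) g‖ ≤ ‖g‖ * ‖f‖ := fun f g => by
    refine (ContinuousLinearMap.le_opNorm _ _).trans ?_
    rw [LinearIsometryEquiv.norm_map, mul_comm]
    gcongr
    exact hLb f
  obtain ⟨T, hT₀⟩ : ∃ T : G → F →L[ℂ] E, ∀ g f, T g f = ContinuousLinearMap.adjoint (L f) g :=
    ⟨fun g => LinearMap.mkContinuous
      { toFun := fun f => ContinuousLinearMap.adjoint (L f) g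
        map_add' := fun f f' => by rw [hLadd, map_add, add_apply]
        map_smul' := fun c f => by
          rw [hLsmul, map_smulₛₗ, RCLike.conj_conj, smul_apply, RingHom.id_apply] }
      ‖g‖ fun f => hTb f g, fun _ _ => rfl⟩
  have hT : ∀ f g x, ⟪f, ContinuousLinearMap.adjoint (T g) x⟫_ℂ = ⟪g, L f x⟫_ℂ := fun f g x => by
    rw [ContinuousLinearMap.adjoint_inner_right, hT₀, ContinuousLinearMap.adjoint_inner_left]
  refine ⟨fun g => ContinuousLinearMap.adjoint (T g), L, hT, fun i => ?_⟩
  ext x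
  refine ext_inner_left ℂ fun f => ?_
  rw [hT, hL]

theorem tsum_sq_norm_contraction {K : G → E →L[ℂ] F} {L : F → E →L[ℂ] G}
    (h : ∀ f g x, ⟪f, K g x⟫_ℂ = ⟪g, L f x⟫_ℂ) (f : HilbertBasis ι ℂ F) (g : HilbertBasis κ ℂ G)
    (x : E) : ∑' k, ENNReal.ofReal (‖K (g k) x‖ ^ 2) = ∑' j, ENNReal.ofReal (‖L (f j) x‖ ^ 2) := by
  simp_rw [← tsum_sq_inner_eq f, ← tsum_sq_inner_eq g, h]
  exact ENNReal.tsum_comm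

theorem norm_sq_le_tsum {T : E →L[ℂ] F} (r : HilbertBasis ι ℂ E) {c : ℝ} (hc : HasSum (fun k => ‖T (r k)‖ ^ 2) c) :
    ‖T‖ ^ 2 ≤ c := by
  have hc0 : 0 ≤ c := hc.nonneg fun k => by positivity
  have h : ‖ContinuousLinearMap.adjoint T‖ ≤ Real.sqrt c := by
    refine ContinuousLinearMap.opNorm_le_bound _ (Real.sqrt_nonneg _) fun x => ?_
    refine Real.le_sqrt_of_sq_le ?_ |>.trans_eq (Real.sqrt_mul_self (by positivity))
    rw [mul_mul_mul_comm, Real.mul_self_sqrt hc0]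
    refine hasSum_le (fun k => ?_) (hasSum_sq_inner r _) (hc.mul_right (‖x‖ * ‖x‖))
    rw [ContinuousLinearMap.adjoint_inner_right, ← sq, ← mul_pow]
    gcongr
    exact norm_inner_le_norm _ _
  rw [LinearIsometryEquiv.norm_map] at h
  calc ‖T‖ ^ 2 ≤ Real.sqrt c ^ 2 := by gcongr
    _ = c := Real.sq_sqrt hc0

theorem sqrt_comp_sqrt {A R : E →L[ℂ] E} (hR : ContinuousLinearMap.adjoint R = R)
    (hi : ∀ x y, ⟪x, A y⟫_ℂ = ⟪R x, R y⟫_ℂ) : A = R ∘L R := by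
  ext y
  refine ext_inner_left ℂ fun x => ?_
  rw [hi, inner_adjoint_eq_self hR]; rfl

theorem qf_krausMap_eq {V : ℕ → E →L[ℂ] F} {b : HilbertBasis ℕ ℂ G}
    {K : G → E →L[ℂ] F} {L : F → E →L[ℂ] G}
    (hKL : ∀ f g x, ⟪f, K g x⟫_ℂ = ⟪g, L f x⟫_ℂ) (hK : ∀ i, K (b i) = V i)
    (hle : ∀ x, ∑' i, ENNReal.ofReal (‖V i x‖ ^ 2) ≤ ENNReal.ofReal (‖x‖ ^ 2))
    {A R : E →L[ℂ] E} (hA : PosTrace A) (hR : ContinuousLinearMap.adjoint R = R)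
    (hi : ∀ x y, ⟪x, A y⟫_ℂ = ⟪R x, R y⟫_ℂ) (hq : ∀ x, qf A x = ‖R x‖ ^ 2)
    (r : HilbertBasis ι ℂ E) (f : F) :
    ENNReal.ofReal (qf (krausMap V A) f) = ∑' k, ENNReal.ofReal (‖L f (R (r k))‖ ^ 2) := by
  have htot : ∑' i, ∑' k, ENNReal.ofReal (‖V i (R (r k))‖ ^ 2) ≤ traceENN A := by
    rw [ENNReal.tsum_comm, traceENN_eq hA.1 r]
    refine ENNReal.tsum_le_tsum fun k => ?_
    rw [hq]
    exact hle _
  have hne := ne_top_of_le_ne_top hA.2 htot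
  have hsumm : Summable fun i => V i ∘L A ∘L ContinuousLinearMap.adjoint (V i) := by
    refine Summable.of_norm_bounded (ENNReal.summable_toReal hne) fun i => ?_
    have h1 : V i ∘L A ∘L ContinuousLinearMap.adjoint (V i) =
        (V i ∘L R) ∘L ContinuousLinearMap.adjoint (V i ∘L R) := by
      rw [ContinuousLinearMap.adjoint_comp, hR, sqrt_comp_sqrt hR hi]; rfl
    have h2 : HasSum (fun k => ‖(V i ∘L R) (r k)‖ ^ 2)
        (∑' k, ENNReal.ofReal (‖V i (R (r k))‖ ^ 2)).toReal :=
      hasSum_of_tsum_ofReal (fun k => by positivity) ENNReal.toReal_nonneg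
        (ENNReal.ofReal_toReal (ENNReal.ne_top_of_tsum_ne_top hne i)).symm
    refine le_trans ?_ (norm_sq_le_tsum r h2)
    rw [h1]
    refine (ContinuousLinearMap.opNorm_comp_le _ _).trans_eq ?_
    rw [LinearIsometryEquiv.norm_map, sq]
  have h3 : HasSum (fun i => qf (V i ∘L A ∘L ContinuousLinearMap.adjoint (V i)) f)
      (qf (krausMap V A) f) := by
    exact hsumm.hasSum.mapL (Complex.reCLM.comp (((innerSL ℂ f).comp
      (ContinuousLinearMap.apply ℂ F f)).restrictScalars ℝ))
  have h4 : ∀ i, qf (V i ∘L A ∘L ContinuousLinearMap.adjoint (V i)) f =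
      ‖R (ContinuousLinearMap.adjoint (V i) f)‖ ^ 2 := fun i => by
    rw [← hq]; exact qf_conj (V i) A f
  simp_rw [h4] at h3
  rw [← tsum_ofReal_of_hasSum (fun i => by positivity) h3]
  simp_rw [← tsum_sq_inner_eq r, ← tsum_sq_inner_eq b, ← hKL, hK]
  rw [ENNReal.tsum_comm]
  refine tsum_congr fun k => tsum_congr fun i => ?_
  rw [← inner_adjoint_eq_self hR, ContinuousLinearMap.adjoint_inner_right, norm_inner_symm]

theorem qf_complementary_eq {V : ℕ → E →L[ℂ] F} {b : HilbertBasis ℕ ℂ G}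
    {K : G → E →L[ℂ] F} {L : F → E →L[ℂ] G}
    (hKL : ∀ f g x, ⟪f, K g x⟫_ℂ = ⟪g, L f x⟫_ℂ) (hK : ∀ i, K (b i) = V i)
    (hle : ∀ x, ∑' i, ENNReal.ofReal (‖V i x‖ ^ 2) ≤ ENNReal.ofReal (‖x‖ ^ 2))
    {A R : E →L[ℂ] E} (hA : PosTrace A) (hR : ContinuousLinearMap.adjoint R = R)
    (hi : ∀ x y, ⟪x, A y⟫_ℂ = ⟪R x, R y⟫_ℂ) (hq : ∀ x, qf A x = ‖R x‖ ^ 2)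
    {B : G →L[ℂ] G} (hB : ∀ i j, ⟪b i, B (b j)⟫_ℂ =
      traceC (V i ∘L A ∘L ContinuousLinearMap.adjoint (V j)))
    (r : HilbertBasis ι ℂ E) (g : G) :
    ENNReal.ofReal (qf B g) = ∑' k, ENNReal.ofReal (‖K g (R (r k))‖ ^ 2) := by
  obtain ⟨c, hc⟩ : ∃ c : HilbertBasis (stdONB F) ℂ F, ∀ v, c v = v :=
    IsONB.exists_hilbertBasis (exists_isONB F).choose_spec
  have htot : ∑' p : stdONB F × ι, ENNReal.ofReal (‖L (c p.1) (R (r p.2))‖ ^ 2) ≤ traceENN A := by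
    rw [ENNReal.tsum_prod', ENNReal.tsum_comm, traceENN_eq hA.1 r]
    refine ENNReal.tsum_le_tsum fun k => ?_
    rw [hq]
    have h := tsum_sq_norm_contraction hKL c b (R (r k))
    simp_rw [hK] at h
    dsimp only
    rw [← h]
    exact hle _
  have hsumm : Summable fun p : stdONB F × ι => ‖L (c p.1) (R (r p.2))‖ ^ 2 := by
    refine (ENNReal.summable_toReal (ne_top_of_le_ne_top hA.2 htot)).congr fun p => ?_
    rw [ENNReal.toReal_ofReal (by positivity)]
  obtain ⟨B', -, -, hgen, hm⟩ := exists_op_of_summable hsumm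
  have hinner : ∀ i v k, ⟪b i, L (c v) (R (r k))⟫_ℂ =
      ⟪R (ContinuousLinearMap.adjoint (V i) (c v)), r k⟫_ℂ := fun i v k => by
    rw [← hKL, hK, inner_adjoint_eq_self hR, ContinuousLinearMap.adjoint_inner_left]
  have hBB : B = B' := by
    have hent : ∀ i j, ⟪b i, B (b j)⟫_ℂ = ⟪b i, B' (b j)⟫_ℂ := fun i j => by
      rw [hB, traceC]
      refine HasSum.tsum_eq ?_
      refine (hm (b i) (b j)).prod_fiberwise fun v => ?_
      have h := r.hasSum_inner_mul_inner (R (ContinuousLinearMap.adjoint (V i) (c v)))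
        (R (ContinuousLinearMap.adjoint (V j) (c v)))
      rw [← hi, ContinuousLinearMap.adjoint_inner_left] at h
      rw [← hc v]
      refine h.congr_fun fun k => ?_
      rw [hinner, ← inner_conj_symm _ (b j), hinner, inner_conj_symm]
    have hcol : ∀ j, B (b j) = B' (b j) := fun j => by
      refine b.repr.injective ?_
      ext i
      rw [HilbertBasis.repr_apply_apply, HilbertBasis.repr_apply_apply, hent]
    refine ContinuousLinearMap.ext_on ((Submodule.dense_iff_topologicalClosure_eq_top).2
      b.dense_span) ?_
    rintro _ ⟨j, rfl⟩
    exact hcol j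
  rw [hBB, ← tsum_ofReal_of_hasSum (fun i => by positivity) (hgen g), ENNReal.tsum_prod',
    ENNReal.tsum_comm]
  refine tsum_congr fun k => ?_
  rw [← tsum_sq_inner_eq c]
  refine tsum_congr fun v => ?_
  rw [hKL, norm_inner_symm]

end Dilation

section Marginals

variable {ι κ : Type*}

theorem exists_marginals {z : ι × κ → ℝ} {T : ℝ} (hz : ∀ p, 0 ≤ z p) (hT : HasSum z T)
    {lam : ι → ℝ} {mu : κ → ℝ} (hlam : ∀ i, 0 ≤ lam i) (hmu : ∀ k, 0 ≤ mu k)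
    (h₁ : ∀ i, ∑' k, ENNReal.ofReal (z (i, k)) ≤ ENNReal.ofReal (lam i))
    (h₂ : ∀ k, ∑' i, ENNReal.ofReal (z (i, k)) ≤ ENNReal.ofReal (mu k)) :
    ∃ (x : ι → ℝ) (y : κ → ℝ),
      ((∀ i, 0 ≤ x i) ∧ (∀ i, x i ≤ lam i) ∧ ∑' i, x i = T) ∧
      ((∀ k, 0 ≤ y k) ∧ (∀ k, y k ≤ mu k) ∧ ∑' k, y k = T) ∧
      clEntropy z ≤ clEntropy x + clEntropy y := by
  have hs : Summable fun p : κ × ι => z p.swap := (Equiv.prodComm κ ι).summable_iff.2 hT.summable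
  have hx : ∀ i, HasSum (fun k => z (i, k)) (∑' k, z (i, k)) := fun i =>
    (hT.summable.prod_factor i).hasSum
  have hy : ∀ k, HasSum (fun i => z (i, k)) (∑' i, z (i, k)) := fun k => (hs.prod_factor k).hasSum
  have hT' : HasSum (fun p : κ × ι => z p.swap) T := (Equiv.prodComm κ ι).hasSum_iff.2 hT
  refine ⟨fun i => ∑' k, z (i, k), fun k => ∑' i, z (i, k),
    ⟨fun i => tsum_nonneg fun k => hz _, fun i => ?_, (hT.prod_fiberwise hx).tsum_eq⟩,
    ⟨fun k => tsum_nonneg fun i => hz _, fun k => ?_, (hT'.prod_fiberwise hy).tsum_eq⟩,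
    clEntropy_prod_le hz hT hx hy⟩
  · rw [← ENNReal.ofReal_le_ofReal_iff (hlam i), ← tsum_ofReal_of_hasSum (fun k => hz _) (hx i)]
    exact h₁ i
  · rw [← ENNReal.ofReal_le_ofReal_iff (hmu k), ← tsum_ofReal_of_hasSum (fun i => hz _) (hy k)]
    exact h₂ k

end Marginals

section EigenSeq

variable {E F ι : Type*}
variable [NormedAddCommGroup E] [InnerProductSpace ℂ E] [CompleteSpace E]
variable [NormedAddCommGroup F] [InnerProductSpace ℂ F] [CompleteSpace F]

open scoped InnerProductSpace

theorem IsEigenSeq.exists_hasSum {T : E →L[ℂ] E} {μ : ℕ → ℝ} (h : IsEigenSeq T μ)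
    (hs : (T : E →ₗ[ℂ] E).IsSymmetric) :
    ∃ e : ℕ → E, (∀ x, HasSum (fun i => μ i * ‖⟪e i, x⟫_ℂ‖ ^ 2) (qf T x)) ∧
      ∀ x, ∑' i, ENNReal.ofReal (‖⟪e i, x⟫_ℂ‖ ^ 2) ≤ ENNReal.ofReal (‖x‖ ^ 2) := by
  obtain ⟨e, horth, hnorm, heig, hker⟩ := h
  have hv : Orthonormal ℂ fun i : {i // μ i ≠ 0} => e i :=
    ⟨fun i => (hnorm i).1 i.2, fun i j hij => horth _ _ fun h => hij (Subtype.ext h)⟩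
  have hsupp : ∀ i, i ∉ {i | μ i ≠ 0} → e i = 0 := fun i hi => (hnorm i).2 (not_not.1 hi)
  obtain ⟨w, b, hw, hb⟩ := hv.toSubtypeRange.exists_hilbertBasis_extension
  have hqf : ∀ i : {i // μ i ≠ 0}, qf T (e i) = μ i := fun i => by
    rw [qf, heig, inner_smul_right, inner_self_eq_norm_sq_to_K, hv.1 i]
    simp
  have hz : ∀ v : w, (¬∃ i : {i // μ i ≠ 0}, e i = v) → T v = 0 := fun v hvr => by
    refine hker _ fun i => ?_
    by_cases hi : μ i = 0
    · rw [(hnorm i).2 hi, inner_zero_left]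
    · have hei : e i ∈ w := hw ⟨⟨i, hi⟩, rfl⟩
      have hne : (⟨e i, hei⟩ : w) ≠ v := fun h => hvr ⟨⟨i, hi⟩, congrArg Subtype.val h⟩
      have := b.orthonormal.2 hne
      rwa [hb] at this
  have heigb : IsEigenbasis T b fun v => qf T v := fun v => by
    have hbv : b v = v := congrFun hb v
    dsimp only
    rw [hbv]
    by_cases hvr : ∃ i : {i // μ i ≠ 0}, e i = v
    · obtain ⟨i, hi⟩ := hvr
      rw [← hi, hqf, heig]
    · simp [qf, hz v hvr]
  refine ⟨e, fun x => ?_, fun x => ?_⟩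
  · have h1 := heigb.hasSum_mul_sq hs x
    let φ : {i // μ i ≠ 0} → w := fun i => ⟨e i, hw ⟨i, rfl⟩⟩
    have hφ : Function.Injective φ := fun i j hij =>
      hv.linearIndependent.injective (congrArg Subtype.val hij)
    have h2 := (hφ.hasSum_iff ?_).2 h1
    · refine (hasSum_subtype_iff_of_support_subset (s := {i | μ i ≠ 0}) ?_).1 ?_
      · intro i hi hμ
        exact hi (by simp [hμ])
      · refine h2.congr_fun fun i => ?_
        simp [φ, hb, hqf i]
    · intro v hvr
      have h3 : T v = 0 := hz v fun ⟨i, hi⟩ => hvr ⟨i, Subtype.ext hi⟩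
      simp [qf, h3]
  · refine le_trans (le_of_eq ?_) (tsum_sq_inner_le hv x)
    refine (tsum_subtype_eq_of_support_subset (s := {i | μ i ≠ 0})
      (f := fun i => ENNReal.ofReal (‖⟪e i, x⟫_ℂ‖ ^ 2)) ?_).symm
    intro i hi hμ
    exact hi (by simp [hsupp i (not_not.2 hμ)])

end EigenSeq

section DominatedOutput

universe uE uF uG
variable {E : Type uE} {F : Type uF} {G : Type uG}
variable [NormedAddCommGroup E] [InnerProductSpace ℂ E] [CompleteSpace E]
variable [NormedAddCommGroup F] [InnerProductSpace ℂ F] [CompleteSpace F]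
variable [NormedAddCommGroup G] [InnerProductSpace ℂ G] [CompleteSpace G]

open scoped InnerProductSpace

theorem ofReal_sq_norm_apply_le {Q : E →L[ℂ] E} (hQ : ∀ x, ‖Q x‖ ≤ ‖x‖) (x : E) :
    ENNReal.ofReal (‖Q x‖ ^ 2) ≤ ENNReal.ofReal (‖x‖ ^ 2) := by
  gcongr
  exact hQ x

theorem clEntropy_sumElim_le_add {ι κ : Type*} {x : ι → ℝ} {y : κ → ℝ} {X Y : ℝ}
    (hx : ∀ i, 0 ≤ x i) (hy : ∀ i, 0 ≤ y i) (hX : HasSum x X) (hY : HasSum y Y) :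
    clEntropy (Sum.elim x y) ≤ clEntropy x + clEntropy y + ENNReal.ofReal (X + Y) := by
  have hX0 : 0 ≤ X := hX.nonneg hx
  have hY0 : 0 ≤ Y := hY.nonneg hy
  have h₁ := mul_log_div_le hX0 (le_add_of_nonneg_right hY0 : X ≤ X + Y) one_pos
  have h₂ := mul_log_div_le hY0 (le_add_of_nonneg_left hX0 : Y ≤ X + Y) one_pos
  simp only [Real.log_one, mul_zero, div_one, zero_add] at h₁ h₂
  refine (clEntropy_sumElim_le hx hy hX hY).trans (add_le_add le_rfl ?_)
  rw [add_comm (ENNReal.ofReal (X * _)), ENNReal.ofReal_add hX0 hY0]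
  exact add_le_add (ENNReal.ofReal_le_ofReal (by linarith)) (ENNReal.ofReal_le_ofReal (by linarith))

theorem _root_.HasSum.exists_of_sumElim {ι κ : Type*} {x : ι → ℝ} {y : κ → ℝ} {t : ℝ}
    (h : HasSum (Sum.elim x y) t) : ∃ X Y, HasSum x X ∧ HasSum y Y ∧ X + Y = t := by
  have hx : Summable x := h.summable.comp_injective Sum.inl_injective
  have hy : Summable y := h.summable.comp_injective Sum.inr_injective
  exact ⟨_, _, hx.hasSum, hy.hasSum, (HasSum.sum (f := Sum.elim x y) hx.hasSum hy.hasSum).unique h⟩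

/-- The entropy of an output is dominated by that of the complementary output and of the input. -/
theorem dominated_output {K : G → E →L[ℂ] F} {L : F → E →L[ℂ] G}
    (hKL : ∀ f g x, ⟪f, K g x⟫_ℂ = ⟪g, L f x⟫_ℂ)
    {A R : E →L[ℂ] E} (hA : PosTrace A) (hq : ∀ x, qf A x = ‖R x‖ ^ 2)
    {B : F →L[ℂ] F} (hB : PosTrace B) {C : G →L[ℂ] G} (hC : PosTrace C)
    {ι : Type uE} {κ : Type uG} {r : HilbertBasis ι ℂ E} {g : HilbertBasis κ ℂ G}
    {lam : ι → ℝ} {mu : κ → ℝ} (hr : IsEigenbasis A r lam) (hg : IsEigenbasis C g mu)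
    (hle : ∀ x, ∑' k, ENNReal.ofReal (‖K (g k) x‖ ^ 2) ≤ ENNReal.ofReal (‖x‖ ^ 2))
    (hBf : ∀ f, ENNReal.ofReal (qf B f) = ∑' i, ENNReal.ofReal (‖L f (R (r i))‖ ^ 2))
    (hCg : ∀ h, ENNReal.ofReal (qf C h) = ∑' i, ENNReal.ofReal (‖K h (R (r i))‖ ^ 2)) :
    Dominated C A B 0 := fun Q hQ => by
  have hgen : Generates (fun p : κ × ι => K (g p.1) (R (r p.2))) B := fun f => by
    refine hasSum_of_tsum_ofReal (fun p => by positivity) (qf_nonneg hB.1 f) ?_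
    rw [hBf, ENNReal.tsum_prod', ENNReal.tsum_comm]
    refine tsum_congr fun i => ?_
    rw [← tsum_sq_inner_eq g]
    refine tsum_congr fun k => ?_
    rw [← hKL, norm_inner_symm]
  have hgenQ := hgen.conj Q
  obtain ⟨x, y, hx, hy, hxy⟩ := exists_marginals (lam := mu) (mu := lam) (fun p => by positivity)
    (hgenQ.hasSum_norm_sq (hB.conj Q)) (hg.nonneg hC) (hr.nonneg hA) (fun k => by
      rw [← hg.qf_apply, hCg]
      exact ENNReal.tsum_le_tsum fun i => ofReal_sq_norm_apply_le hQ _) (fun i => by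
      rw [← hr.qf_apply, hq]
      exact (ENNReal.tsum_le_tsum fun k => ofReal_sq_norm_apply_le hQ _).trans (hle _))
  refine ⟨κ, ι, g, r, mu, lam, x, y, hg, hr, ⟨hx.1, hx.2.1, hx.2.2.le⟩,
    ⟨hy.1, hy.2.1, hy.2.2.le⟩, ?_⟩
  rw [zero_mul, ENNReal.ofReal_zero, add_zero]
  exact (hgenQ.qEntropy_le (hB.conj Q)).trans hxy

/-- The entropy of the input is dominated by those of the two complementary outputs, when the
defect `1 - S` has sufficiently rapidly decreasing eigenvalues. -/
theorem dominated_input {K : G → E →L[ℂ] F} {L : F → E →L[ℂ] G}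
    (hKL : ∀ f g x, ⟪f, K g x⟫_ℂ = ⟪g, L f x⟫_ℂ)
    {A R : E →L[ℂ] E} (hA : PosTrace A) (hR : ContinuousLinearMap.adjoint R = R)
    (hq : ∀ x, qf A x = ‖R x‖ ^ 2)
    {B : F →L[ℂ] F} (hB : PosTrace B) {C : G →L[ℂ] G} (hC : PosTrace C)
    {ι : Type uF} {κ : Type uG} {ι' : Type*} {f : HilbertBasis ι ℂ F} {g : HilbertBasis κ ℂ G}
    {r : HilbertBasis ι' ℂ E}
    {lam : ι → ℝ} {mu : κ → ℝ} (hf : IsEigenbasis B f lam) (hg : IsEigenbasis C g mu)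
    {S : E →L[ℂ] E} (hS0 : ∀ x, 0 ≤ qf S x)
    (hS : ∀ x, ∑' k, ENNReal.ofReal (‖K (g k) x‖ ^ 2) = ENNReal.ofReal (qf S x))
    (hBf : ∀ f, ENNReal.ofReal (qf B f) = ∑' i, ENNReal.ofReal (‖L f (R (r i))‖ ^ 2))
    (hCg : ∀ h, ENNReal.ofReal (qf C h) = ∑' i, ENNReal.ofReal (‖K h (R (r i))‖ ^ 2))
    {e : ℕ → E} {ν : ℕ → ℝ} {l : ℝ} (hl : 0 < l) (hexp : expSum ν l ≠ ∞)
    (he : ∀ x, HasSum (fun i => ν i ^ 2 * ‖⟪e i, x⟫_ℂ‖ ^ 2) (qf (1 - S) x))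
    (hbessel : ∀ x, ∑' i, ENNReal.ofReal (‖⟪e i, x⟫_ℂ‖ ^ 2) ≤ ENNReal.ofReal (‖x‖ ^ 2)) :
    Dominated B C A (1 + l + Real.log ((expSum ν l).toReal + 1)) := fun Q hQ => by
  have hAQ := hA.conj Q
  set t := (traceENN (conj Q A)).toReal with ht
  set Z := (expSum ν l).toReal + 1 with hZ
  have hZ0 : 0 ≤ Real.log Z := Real.log_nonneg (by
    rw [hZ]; linarith [ENNReal.toReal_nonneg (a := expSum ν l)])
  obtain ⟨τ, hτ₀⟩ : ∃ τ : ι × κ → E,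
      ∀ j k, τ (j, k) = R (ContinuousLinearMap.adjoint (K (g k)) (f j)) :=
    ⟨fun p => R (ContinuousLinearMap.adjoint (K (g p.2)) (f p.1)), fun _ _ => rfl⟩
  obtain ⟨σ, hσ₀⟩ : ∃ σ : ℕ → E, ∀ i, σ i = (ν i : ℂ) • R (e i) := ⟨_, fun _ => rfl⟩
  have hτ : ∀ x p, ‖⟪τ p, x⟫_ℂ‖ = ‖⟪f p.1, K (g p.2) (R x)⟫_ℂ‖ := fun x p => by
    rw [hτ₀, inner_adjoint_eq_self hR, ContinuousLinearMap.adjoint_inner_left]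
  have hgen : Generates (Sum.elim τ σ) A := fun x => by
    have h1 : HasSum (fun p => ‖⟪τ p, x⟫_ℂ‖ ^ 2) (qf S (R x)) := by
      refine hasSum_of_tsum_ofReal (fun p => by positivity) (hS0 _) ?_
      rw [← hS, ENNReal.tsum_prod', ENNReal.tsum_comm]
      refine tsum_congr fun k => ?_
      rw [← tsum_sq_inner_eq f]
      exact tsum_congr fun i => by rw [hτ]
    have h2 : HasSum (fun i => ‖⟪σ i, x⟫_ℂ‖ ^ 2) (qf (1 - S) (R x)) := by
      refine (he (R x)).congr_fun fun i => ?_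
      rw [hσ₀, inner_smul_left, inner_adjoint_eq_self hR, norm_mul, mul_pow]
      simp
    have h3 := HasSum.sum (f := fun p => ‖⟪Sum.elim τ σ p, x⟫_ℂ‖ ^ 2) h1 h2
    rwa [qf_one_sub, add_sub_cancel, ← hq] at h3
  have hgenQ := hgen.conj Q
  have hsum := hgenQ.hasSum_norm_sq hAQ
  rw [← ht] at hsum
  have helim : (fun p => ‖Q (Sum.elim τ σ p)‖ ^ 2) =
      Sum.elim (fun p => ‖Q (τ p)‖ ^ 2) (fun i => ‖Q (σ i)‖ ^ 2) := by
    funext p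
    cases p <;> rfl
  rw [helim] at hsum
  obtain ⟨T₁, T₂, hs₁, hs₂, hT⟩ := hsum.exists_of_sumElim
  have hT₁0 : 0 ≤ T₁ := hs₁.nonneg fun p => by positivity
  have hT₂0 : 0 ≤ T₂ := hs₂.nonneg fun p => by positivity
  obtain ⟨x, y, hx, hy, hxy⟩ := exists_marginals (fun p => by positivity) hs₁
    (hf.nonneg hB) (hg.nonneg hC) (fun j => by
      rw [← hf.qf_apply, hBf]
      refine (ENNReal.tsum_le_tsum fun k => ofReal_sq_norm_apply_le hQ _).trans_eq ?_
      refine Eq.trans ?_ (tsum_sq_norm_eq_adjoint (L (f j) ∘L R) r g).symm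
      refine tsum_congr fun k => ?_
      rw [ContinuousLinearMap.adjoint_comp, hR]
      have : ContinuousLinearMap.adjoint (K (g k)) (f j) =
          ContinuousLinearMap.adjoint (L (f j)) (g k) := ext_inner_right ℂ fun z => by
        rw [ContinuousLinearMap.adjoint_inner_left, ContinuousLinearMap.adjoint_inner_left, hKL]
      rw [ContinuousLinearMap.comp_apply, ← this, hτ₀]) (fun k => by
      rw [← hg.qf_apply, hCg]
      refine (ENNReal.tsum_le_tsum fun j => ofReal_sq_norm_apply_le hQ _).trans_eq ?_
      refine Eq.trans ?_ (tsum_sq_norm_eq_adjoint (K (g k) ∘L R) r f).symm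
      refine tsum_congr fun j => ?_
      rw [ContinuousLinearMap.adjoint_comp, hR, hτ₀, ContinuousLinearMap.comp_apply])
  refine ⟨ι, κ, f, g, lam, mu, x, y, hf, hg, ⟨hx.1, hx.2.1, by rw [hx.2.2]; linarith⟩,
    ⟨hy.1, hy.2.1, by rw [hy.2.2]; linarith⟩, ?_⟩
  have hYle : ∑' i, ENNReal.ofReal (‖Q (R (e i))‖ ^ 2) ≤ traceENN (conj Q A) := by
    simp_rw [← tsum_sq_inner_eq r]
    rw [ENNReal.tsum_comm, traceENN_eq hAQ.1 r]
    refine ENNReal.tsum_le_tsum fun k => ?_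
    rw [qf_conj, hq]
    refine le_trans (le_of_eq (tsum_congr fun i => ?_)) (hbessel _)
    rw [← inner_adjoint_eq_self hR, ContinuousLinearMap.adjoint_inner_right, norm_inner_symm]
  have hYsum : HasSum (fun i => ‖Q (R (e i))‖ ^ 2)
      (∑' i, ENNReal.ofReal (‖Q (R (e i))‖ ^ 2)).toReal :=
    hasSum_of_tsum_ofReal (fun i => by positivity) ENNReal.toReal_nonneg
      (ENNReal.ofReal_toReal (ne_top_of_le_ne_top hAQ.2 hYle)).symm
  have hYt : (∑' i, ENNReal.ofReal (‖Q (R (e i))‖ ^ 2)).toReal ≤ t :=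
    ENNReal.toReal_mono hAQ.2 hYle
  have hσ : (fun i => ‖Q (σ i)‖ ^ 2) = fun i => ν i ^ 2 * ‖Q (R (e i))‖ ^ 2 := by
    funext i
    simp [hσ₀, norm_smul, mul_pow]
  have hent : clEntropy (fun i => ‖Q (σ i)‖ ^ 2) ≤ ENNReal.ofReal (l * t + t * Real.log Z) := by
    have hs₃ := hs₂
    rw [hσ] at hs₃ ⊢
    refine (clEntropy_le_of_expSum hl (fun i => by positivity) hexp hs₃ hYsum).trans ?_
    gcongr
    linarith
  have ht0 : 0 ≤ t := ENNReal.toReal_nonneg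
  calc qEntropy (conj Q A) ≤ clEntropy fun p => ‖Q (Sum.elim τ σ p)‖ ^ 2 :=
        hgenQ.qEntropy_le hAQ
    _ ≤ (clEntropy x + clEntropy y) + ENNReal.ofReal (l * t + t * Real.log Z) +
        ENNReal.ofReal t := by
      rw [helim]
      refine (clEntropy_sumElim_le_add (fun p => by positivity) (fun i => by positivity)
        hs₁ hs₂).trans ?_
      rw [hT]
      exact add_le_add (add_le_add hxy hent) le_rfl
    _ = clEntropy x + clEntropy y + ENNReal.ofReal ((1 + l + Real.log Z) * t) := by
      rw [add_assoc, ← ENNReal.ofReal_add (by positivity) ht0]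
      congr 2
      ring

end DominatedOutput

section Complementary

variable {E F G : Type*}
variable [NormedAddCommGroup E] [InnerProductSpace ℂ E] [CompleteSpace E]
variable [NormedAddCommGroup F] [InnerProductSpace ℂ F] [CompleteSpace F]
variable [NormedAddCommGroup G] [InnerProductSpace ℂ G] [CompleteSpace G]

open scoped InnerProductSpace

theorem traceENN_le_of_contraction {ι κ : Type*} {L : F → E →L[ℂ] G} {A R : E →L[ℂ] E}
    (hA : A.IsPositive) (hq : ∀ x, qf A x = ‖R x‖ ^ 2) {B : F →L[ℂ] F} (hB : B.IsPositive)
    (f : HilbertBasis κ ℂ F) (r : HilbertBasis ι ℂ E)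
    (hle : ∀ x, ∑' k, ENNReal.ofReal (‖L (f k) x‖ ^ 2) ≤ ENNReal.ofReal (‖x‖ ^ 2))
    (hBf : ∀ f, ENNReal.ofReal (qf B f) = ∑' i, ENNReal.ofReal (‖L f (R (r i))‖ ^ 2)) :
    traceENN B ≤ traceENN A := by
  rw [traceENN_eq hB f, traceENN_eq hA r]
  simp_rw [hBf]
  rw [ENNReal.tsum_comm]
  refine ENNReal.tsum_le_tsum fun i => ?_
  rw [hq]
  exact hle _

theorem isSymmetric_one_sub_of_kraus {V : ℕ → E →L[ℂ] F} {S : E →L[ℂ] E}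
    (hS : ∀ x : E, HasSum (fun i => (ContinuousLinearMap.adjoint (V i)) (V i x)) (S x)) :
    ((1 - S : E →L[ℂ] E) : E →ₗ[ℂ] E).IsSymmetric := fun x y => by
  have h₁ : HasSum (fun i => ⟪V i x, V i y⟫_ℂ) ⟪x, S y⟫_ℂ := by
    refine ((hS y).mapL (innerSL ℂ x)).congr_fun fun i => ?_
    rw [innerSL_apply_apply, ContinuousLinearMap.adjoint_inner_right]
  have h₂ : HasSum (fun i => ⟪V i y, V i x⟫_ℂ) ⟪y, S x⟫_ℂ := by
    refine ((hS x).mapL (innerSL ℂ y)).congr_fun fun i => ?_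
    rw [innerSL_apply_apply, ContinuousLinearMap.adjoint_inner_right]
  have h₃ : ⟪S x, y⟫_ℂ = ⟪x, S y⟫_ℂ := by
    refine HasSum.unique (f := fun i => ⟪V i x, V i y⟫_ℂ) ?_ h₁
    have h := Complex.hasSum_conj'.2 h₂
    simpa only [inner_conj_symm] using h
  change ⟪x - S x, y⟫_ℂ = ⟪x, y - S y⟫_ℂ
  rw [inner_sub_left, inner_sub_right, h₃]

theorem lamStarSqrtFin_zero : LamStarSqrtFin (0 : E →L[ℂ] E) :=
  ⟨fun _ => 0, fun _ => le_rfl, ⟨fun _ => 0, by simp, by simp, by simp, by simp⟩, 1, one_pos,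
    by simp [expSum]⟩

theorem KrausTP.lamStarSqrtFin {V : ℕ → E →L[ℂ] F} {S : E →L[ℂ] E} (hV : KrausTP V)
    (hS : ∀ x : E, HasSum (fun i => (ContinuousLinearMap.adjoint (V i)) (V i x)) (S x)) :
    LamStarSqrtFin (1 - S) := by
  have h : S = 1 := by
    ext x
    exact (hS x).unique (hV x)
  rw [h, sub_self]
  exact lamStarSqrtFin_zero

end Complementary

/-- Corollary 10 of the paper. Let `Φ(·) = ∑ᵢ Vᵢ(·)Vᵢ*` be a quantum
channel (or a quantum operation with `λ*(√(I − Φ*(I))) < ∞`, where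
`Φ*(I) = S = ∑ᵢ Vᵢ*Vᵢ`) and `Φt` its complementary channel/operation.  If any two of
the three functions `H`, `H_Φ`, `H_Φt` are continuous on a set `𝒜 ⊆ 𝔗₊(ℋ)`, then so is
the third. -/
theorem statement15
    {E F G : Type*}
    [NormedAddCommGroup E] [InnerProductSpace ℂ E] [CompleteSpace E]
    [TopologicalSpace.SeparableSpace E]
    [NormedAddCommGroup F] [InnerProductSpace ℂ F] [CompleteSpace F]
    [TopologicalSpace.SeparableSpace F]
    [NormedAddCommGroup G] [InnerProductSpace ℂ G] [CompleteSpace G]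
    (V : ℕ → (E →L[ℂ] F)) (hV : KrausTNI V)
    (Φ : TraceMap E F) (hΦ : ∀ A, IsTC A → Φ.toFun A = krausMap V A)
    (b : HilbertBasis ℕ ℂ G) (Φt : TraceMap E G)
    (hΦt : ∀ A, IsTC A → ∀ i j : ℕ,
      (inner ℂ (b i) (Φt.toFun A (b j)) : ℂ) =
        traceC (V i ∘L A ∘L ContinuousLinearMap.adjoint (V j)))
    (S : E →L[ℂ] E)
    (hS : ∀ x : E, HasSum (fun i => (ContinuousLinearMap.adjoint (V i)) (V i x)) (S x))
    (hcase : KrausTP V ∨ LamStarSqrtFin (1 - S))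
    (𝒜 : Set (E →L[ℂ] E)) (h𝒜 : 𝒜 ⊆ posTC E) :
    (ContOn qEntropy 𝒜 → ContOn (outEntropy Φ) 𝒜 → ContOn (outEntropy Φt) 𝒜) ∧
    (ContOn qEntropy 𝒜 → ContOn (outEntropy Φt) 𝒜 → ContOn (outEntropy Φ) 𝒜) ∧
    (ContOn (outEntropy Φ) 𝒜 → ContOn (outEntropy Φt) 𝒜 → ContOn qEntropy 𝒜) := by
  have hsq := hasSum_sq_norm_kraus hS
  have hS1 := qf_le_of_krausTNI hV hS
  have hS0 : ∀ x, 0 ≤ qf S x := fun x => (hsq x).nonneg fun i => by positivity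
  have hVe : ∀ x, ∑' i, ENNReal.ofReal (‖V i x‖ ^ 2) = ENNReal.ofReal (qf S x) := fun x =>
    tsum_ofReal_of_hasSum (fun i => by positivity) (hsq x)
  have hVle : ∀ x, ∑' i, ENNReal.ofReal (‖V i x‖ ^ 2) ≤ ENNReal.ofReal (‖x‖ ^ 2) := fun x =>
    (hVe x).trans_le (ENNReal.ofReal_le_ofReal (hS1 x))
  obtain ⟨K, L, hKL, hK⟩ := exists_contractions b hsq hS1
  have hLe : ∀ {ι : Type _} (f : HilbertBasis ι ℂ F) (x : E),
      ∑' j, ENNReal.ofReal (‖L (f j) x‖ ^ 2) = ENNReal.ofReal (qf S x) := fun f x => by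
    rw [← hVe, ← tsum_sq_norm_contraction hKL f b]
    simp_rw [hK]
  obtain ⟨wF, cF, -⟩ := exists_hilbertBasis ℂ F
  obtain ⟨wE, cE, -⟩ := exists_hilbertBasis ℂ E
  have hKe : ∀ {κ : Type _} (g : HilbertBasis κ ℂ G) (x : E),
      ∑' k, ENNReal.ofReal (‖K (g k) x‖ ^ 2) = ENNReal.ofReal (qf S x) := fun g x => by
    rw [tsum_sq_norm_contraction hKL cF g, hLe]
  have hLle : ∀ {ι : Type _} (f : HilbertBasis ι ℂ F) (x : E),
      ∑' j, ENNReal.ofReal (‖L (f j) x‖ ^ 2) ≤ ENNReal.ofReal (‖x‖ ^ 2) := fun f x =>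
    (hLe f x).trans_le (ENNReal.ofReal_le_ofReal (hS1 x))
  have hKle : ∀ {κ : Type _} (g : HilbertBasis κ ℂ G) (x : E),
      ∑' k, ENNReal.ofReal (‖K (g k) x‖ ^ 2) ≤ ENNReal.ofReal (‖x‖ ^ 2) := fun g x =>
    (hKe g x).trans_le (ENNReal.ofReal_le_ofReal (hS1 x))
  have hout : ∀ A, PosTrace A → ∀ R : E →L[ℂ] E, ContinuousLinearMap.adjoint R = R →
      (∀ x y, inner ℂ x (A y) = inner ℂ (R x) (R y)) → (∀ x, qf A x = ‖R x‖ ^ 2) →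
      ∀ {ι : Type _} (r : HilbertBasis ι ℂ E),
      (∀ f, ENNReal.ofReal (qf (Φ.toFun A) f) = ∑' i, ENNReal.ofReal (‖L f (R (r i))‖ ^ 2)) ∧
      ∀ g, ENNReal.ofReal (qf (Φt.toFun A) g) = ∑' i, ENNReal.ofReal (‖K g (R (r i))‖ ^ 2) :=
    fun A hA R hR hi hq ι r => ⟨fun f => by
      rw [hΦ A hA.isTC]
      exact qf_krausMap_eq hKL hK hVle hA hR hi hq r f, fun g =>
      qf_complementary_eq hKL hK hVle hA hR hi hq (hΦt A hA.isTC) r g⟩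
  have hTNI : Φ.TNI := fun A hA hp => by
    have hA' := PosTrace.of_mem_posTC ⟨hp, hA⟩
    obtain ⟨R, hR, hi, hq⟩ := exists_sqrt hp
    exact traceENN_le_of_contraction hp hq (Φ.pos A hA hp) cF cE (hLle cF)
      (hout A hA' R hR hi hq cE).1
  have hTNIt : Φt.TNI := fun A hA hp => by
    have hA' := PosTrace.of_mem_posTC ⟨hp, hA⟩
    obtain ⟨R, hR, hi, hq⟩ := exists_sqrt hp
    exact traceENN_le_of_contraction hp hq (Φt.pos A hA hp) b cE
      (fun x => by simpa only [hK] using hVle x) (hout A hA' R hR hi hq cE).2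
  refine ⟨fun hH hHΦ => ?_, fun hH hHΦt => ?_, fun hHΦ hHΦt => ?_⟩
  · refine contOn_outEntropy_of_dominated (Y := TraceMap.id E) hTNI TraceMap.tni_id hTNIt le_rfl
      (fun A hA => ?_) h𝒜 hHΦ hH
    obtain ⟨R, hR, hi, hq⟩ := exists_sqrt hA.1
    obtain ⟨ι, r, lam, hr⟩ := hA.exists_isEigenbasis
    obtain ⟨κ, f, mu, hf⟩ := (Φ.posTrace hA).exists_isEigenbasis
    obtain ⟨h₁, h₂⟩ := hout A hA R hR hi hq r
    exact dominated_output (fun g f x => (hKL f g x).symm) hA hq (Φt.posTrace hA)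
      (Φ.posTrace hA) hr hf (hLle f) h₂ h₁
  · refine contOn_outEntropy_of_dominated (Y := TraceMap.id E) hTNIt TraceMap.tni_id hTNI le_rfl
      (fun A hA => ?_) h𝒜 hHΦt hH
    obtain ⟨R, hR, hi, hq⟩ := exists_sqrt hA.1
    obtain ⟨ι, r, lam, hr⟩ := hA.exists_isEigenbasis
    obtain ⟨κ, g, mu, hg⟩ := (Φt.posTrace hA).exists_isEigenbasis
    obtain ⟨h₁, h₂⟩ := hout A hA R hR hi hq r
    exact dominated_output hKL hA hq (Φ.posTrace hA) (Φt.posTrace hA) hr hg (hKle g) h₁ h₂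
  · obtain ⟨ν, -, hν, l, hl, hexp⟩ := hcase.elim (fun h => h.lamStarSqrtFin hS) fun h => h
    obtain ⟨e, he, hbessel⟩ := hν.exists_hasSum (isSymmetric_one_sub_of_kraus hS)
    have hlog : 0 ≤ Real.log ((expSum ν l).toReal + 1) :=
      Real.log_nonneg (le_add_of_nonneg_left ENNReal.toReal_nonneg)
    refine contOn_outEntropy_of_dominated (Z := TraceMap.id E)
      (C := 1 + l + Real.log ((expSum ν l).toReal + 1)) hTNI hTNIt TraceMap.tni_id (by positivity)
      (fun A hA => ?_) h𝒜 hHΦ hHΦt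
    obtain ⟨R, hR, hi, hq⟩ := exists_sqrt hA.1
    obtain ⟨ι, f, lam, hf⟩ := (Φ.posTrace hA).exists_isEigenbasis
    obtain ⟨κ, g, mu, hg⟩ := (Φt.posTrace hA).exists_isEigenbasis
    obtain ⟨h₁, h₂⟩ := hout A hA R hR hi hq cE
    exact dominated_input hKL hA hR hq (Φ.posTrace hA) (Φt.posTrace hA) hf hg hS0 (hKe g) h₁ h₂
      hl hexp he hbessel

end QIT
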